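/- arXiv:math/0304217 — 3 statements merged into one kernel-verified Lean document; each statement's English description precedes it below -/
import Mathlib

section
/- For every δ > 0 there exist constants ε = ε(δ) > 0 and c(δ) > 0 such that for every prime q and every nonempty subset A of F = ℤ/qℤ with |A| < |F|^{1−δ}, one has max(|A+A|, |A·A|) ≥ c(δ)·|A|^{1+ε}. -/
open scoped Pointwise

open Finset

/-- Cauchy–Schwarz: a map with few values has many collisions. -/
lemma card_sq_le_card_image_mul_card_collisions {α β : Type*} [DecidableEq β] (s : Finset α)
    (f : α → β) :
    #s ^ 2 ≤ #(s.image f) * #{p ∈ s ×ˢ s | f p.1 = f p.2} := by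
  have h₁ : #s = ∑ b ∈ s.image f, #{a ∈ s | f a = b} :=
    card_eq_sum_card_fiberwise fun a ha => mem_image_of_mem f ha
  have h₂ : #{p ∈ s ×ˢ s | f p.1 = f p.2} = ∑ b ∈ s.image f, #{a ∈ s | f a = b} ^ 2 := by
    rw [card_eq_sum_card_fiberwise (f := fun p : α × α => f p.1) (t := s.image f)
      fun p hp => mem_image_of_mem f (by simp at hp; exact hp.1.1)]
    refine sum_congr rfl fun b _ => ?_
    rw [sq, ← card_product]
    congr 1
    ext ⟨x, y⟩
    simp only [mem_filter, mem_product]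
    grind
  rw [h₁, h₂]
  exact_mod_cast sq_sum_le_card_mul_sum_sq (s := s.image f) (f := fun b => #{a ∈ s | f a = b})

section Field

variable {F : Type*} [Field F]

/-- The dilate `x • G` is covered by at most `L` translates of `G`. -/
def DilateCovered (G : Finset F) (L : ℝ) (x : F) : Prop :=
  ∃ X : Finset F, (#X : ℝ) ≤ L ∧ ∀ g ∈ G, ∃ t ∈ X, x * g - t ∈ G

/-- `G + G` is covered by at most `M` translates of `G`. -/
def SumCovered (G : Finset F) (M : ℝ) : Prop :=
  ∃ Z : Finset F, (#Z : ℝ) ≤ M ∧ ∀ g ∈ G, ∀ h ∈ G, ∃ z ∈ Z, g + h - z ∈ G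

variable {G : Finset F} {L L' M : ℝ} {x y : F}

lemma DilateCovered.nonneg (hx : DilateCovered G L x) : 0 ≤ L := by
  obtain ⟨X, hX, -⟩ := hx
  exact (Nat.cast_nonneg _).trans hX

lemma SumCovered.nonneg (hG : SumCovered G M) : 0 ≤ M := by
  obtain ⟨X, hX, -⟩ := hG
  exact (Nat.cast_nonneg _).trans hX

lemma DilateCovered.neg (hG : ∀ g ∈ G, -g ∈ G) (hx : DilateCovered G L x) :
    DilateCovered G L (-x) := by
  obtain ⟨X, hX, h⟩ := hx
  refine ⟨X, hX, fun g hg => ?_⟩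
  obtain ⟨t, ht, h'⟩ := h (-g) (hG g hg)
  exact ⟨t, ht, by simpa using h'⟩

variable [DecidableEq F]

/-- Among the dilates `x • B` with `x ∈ S`, at least one has a large sum set with `B`. -/
lemma exists_le_card_add_dilate (S B : Finset F) (hS : S.Nonempty) (hB : B.Nonempty) :
    ∃ x ∈ S, min (#B ^ 2) #S ≤ 2 * #((B ×ˢ B).image fun p => p.1 + x * p.2) := by
  set N : F → ℕ := fun x =>
    #{p ∈ (B ×ˢ B) ×ˢ (B ×ˢ B) | p.1.1 + x * p.1.2 = p.2.1 + x * p.2.2}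
  have hsum : ∑ x ∈ S, N x ≤ #S * #B ^ 2 + #B ^ 4 := by
    have hswap : ∑ x ∈ S, N x = ∑ p ∈ (B ×ˢ B) ×ˢ (B ×ˢ B),
        #{x ∈ S | p.1.1 + x * p.1.2 = p.2.1 + x * p.2.2} :=
      sum_card_bipartiteAbove_eq_sum_card_bipartiteBelow
        (fun x (p : (F × F) × F × F) => p.1.1 + x * p.1.2 = p.2.1 + x * p.2.2)
    have hpt : ∀ p ∈ (B ×ˢ B) ×ˢ (B ×ˢ B),
        #{x ∈ S | p.1.1 + x * p.1.2 = p.2.1 + x * p.2.2} ≤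
          (if p.1 = p.2 then #S else 0) + 1 := by
      rintro ⟨⟨a, b⟩, c, d⟩ -
      split_ifs with h
      · exact (card_filter_le _ _).trans (Nat.le_succ _)
      · rw [zero_add, card_le_one]
        intro x hx y hy
        simp only [mem_filter] at hx hy
        have hbd : b ≠ d := by
          rintro rfl
          exact h (Prod.ext (by simpa using hx.2) rfl)
        have : (x - y) * (b - d) = 0 := by linear_combination hx.2 - hy.2
        rcases mul_eq_zero.1 this with h' | h'
        · exact sub_eq_zero.1 h'
        · exact absurd (sub_eq_zero.1 h') hbd
    rw [hswap]
    refine (sum_le_sum hpt).trans ?_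
    rw [sum_add_distrib, sum_product]
    simp only [sum_ite_eq, sum_ite_mem, inter_self, sum_const, smul_eq_mul, card_product]
    apply le_of_eq
    ring
  obtain ⟨x, hx, hNx⟩ : ∃ x ∈ S, #S * N x ≤ #S * #B ^ 2 + #B ^ 4 := by
    by_contra! h
    have := sum_lt_sum_of_nonempty hS h
    rw [← mul_sum, sum_const, smul_eq_mul] at this
    exact absurd (Nat.lt_of_mul_lt_mul_left this) (not_lt.2 hsum)
  refine ⟨x, hx, ?_⟩
  have hcs := card_sq_le_card_image_mul_card_collisions (B ×ˢ B) fun p => p.1 + x * p.2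
  rw [card_product] at hcs
  set M := #((B ×ˢ B).image fun p => p.1 + x * p.2)
  change (#B * #B) ^ 2 ≤ M * N x at hcs
  have hSpos := hS.card_pos
  have hBpos := hB.card_pos
  have key : #S * #B ^ 2 * #B ^ 2 ≤ M * (#S * #B ^ 2 + #B ^ 4) := by
    calc #S * #B ^ 2 * #B ^ 2 = #S * (#B * #B) ^ 2 := by ring
      _ ≤ #S * (M * N x) := by gcongr
      _ = M * (#S * N x) := by ring
      _ ≤ _ := by gcongr
  rcases le_total (#B ^ 2) #S with h | h
  · rw [min_eq_left h]
    refine le_of_mul_le_mul_left (a := #S * #B ^ 2) ?_ (by positivity)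
    calc _ ≤ M * (#S * #B ^ 2 + #B ^ 4) := key
      _ = M * (#S * #B ^ 2 + #B ^ 2 * #B ^ 2) := by ring
      _ ≤ M * (#S * #B ^ 2 + #S * #B ^ 2) := by gcongr
      _ = _ := by ring
  · rw [min_eq_right h]
    refine le_of_mul_le_mul_left (a := #B ^ 4) ?_ (by positivity)
    calc _ = #S * #B ^ 2 * #B ^ 2 := by ring
      _ ≤ M * (#S * #B ^ 2 + #B ^ 4) := key
      _ ≤ M * (#B ^ 2 * #B ^ 2 + #B ^ 4) := by gcongr
      _ = _ := by ring

lemma DilateCovered.mul (hx : DilateCovered G L x) (hy : DilateCovered G L' y) :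
    DilateCovered G (L * L') (x * y) := by
  have hL := hx.nonneg
  obtain ⟨X, hX, h⟩ := hx
  obtain ⟨Y, hY, h'⟩ := hy
  refine ⟨(X ×ˢ Y).image fun p => p.1 + x * p.2, ?_, fun g hg => ?_⟩
  · calc _ ≤ ((#(X ×ˢ Y) : ℕ) : ℝ) := by exact_mod_cast card_image_le
      _ = (#X : ℝ) * #Y := by rw [card_product]; push_cast; rfl
      _ ≤ _ := by gcongr
  · obtain ⟨t, ht, ht'⟩ := h' g hg
    obtain ⟨s, hs, hs'⟩ := h _ ht'
    refine ⟨s + x * t, mem_image.2 ⟨(s, t), by simp [hs, ht], rfl⟩, ?_⟩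
    convert! hs' using 1
    ring

lemma DilateCovered.add (hG : SumCovered G M) (hx : DilateCovered G L x)
    (hy : DilateCovered G L' y) : DilateCovered G (L * L' * M) (x + y) := by
  have hL := hx.nonneg
  have hL' := hy.nonneg
  obtain ⟨X, hX, h⟩ := hx
  obtain ⟨Y, hY, h'⟩ := hy
  obtain ⟨Z, hZ, h''⟩ := hG
  refine ⟨X + Y + Z, ?_, fun g hg => ?_⟩
  · calc _ ≤ ((#X * #Y * #Z : ℕ) : ℝ) := by
          exact_mod_cast card_add_le.trans (Nat.mul_le_mul_right _ card_add_le)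
      _ = (#X : ℝ) * #Y * #Z := by push_cast; rfl
      _ ≤ _ := by gcongr
  · obtain ⟨s, hs, hs'⟩ := h g hg
    obtain ⟨t, ht, ht'⟩ := h' g hg
    obtain ⟨z, hz, hz'⟩ := h'' _ hs' _ ht'
    refine ⟨s + t + z, add_mem_add (add_mem_add hs ht) hz, ?_⟩
    convert! hz' using 1
    ring

lemma DilateCovered.sub (hG : SumCovered G M) (hneg : ∀ g ∈ G, -g ∈ G)
    (hx : DilateCovered G L x) (hy : DilateCovered G L' y) :
    DilateCovered G (L * L' * M) (x - y) :=
  sub_eq_add_neg x y ▸ hx.add hG (hy.neg hneg)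

lemma neg_mem_sub_self {A : Finset F} : ∀ g ∈ A - A, -g ∈ A - A := by
  intro g hg
  obtain ⟨a, ha, b, hb, rfl⟩ := mem_sub.1 hg
  exact mem_sub.2 ⟨b, hb, a, ha, by ring⟩

section Doubling

variable {A : Finset F} {K : ℝ}

lemma card_nsmul_sub_nsmul_le (hA : A.Nonempty) (hK : (#(A + A) : ℝ) ≤ K * #A) (m n : ℕ) :
    (#(m • A - n • A) : ℝ) ≤ K ^ (m + n) * #A := by
  have hApos : (0 : ℝ) < #A := by exact_mod_cast hA.card_pos
  have h := pluennecke_ruzsa_inequality_nsmul_sub_nsmul_add hA A m n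
  have h' : (#(m • A - n • A) : ℝ) ≤ (#(A + A) / #A : ℝ) ^ (m + n) * #A := by
    have := (NNRat.cast_le (K := ℝ)).2 h
    push_cast at this
    exact this
  refine h'.trans ?_
  gcongr
  exact (div_le_iff₀ hApos).2 hK

/-- The difference set of a set with small doubling is an approximate group. -/
lemma sumCovered_sub_self (hA : A.Nonempty) (hK : (#(A + A) : ℝ) ≤ K * #A) :
    SumCovered (A - A) (K ^ 5) := by
  have h := card_nsmul_sub_nsmul_le hA hK 3 2
  have heq : (3 • A - 2 • A : Finset F) = (A - A + (A - A)) + A := by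
    simp only [succ_nsmul, zero_nsmul, zero_add]
    rw [sub_add_sub_comm, sub_add_eq_add_sub]
  rw [heq] at h
  obtain ⟨Z, -, hZ, hcov⟩ := ruzsa_covering_add hA h
  refine ⟨Z, hZ, fun g hg k hk => ?_⟩
  obtain ⟨z, hz, d, hd, hzd⟩ := mem_add.1 (hcov (add_mem_add hg hk))
  exact ⟨z, hz, by rwa [← hzd, add_sub_cancel_left]⟩

/-- If `x • A` meets `A` in a large set, then `x • (A - A)` is covered by few translates of
`A - A`. -/
lemma dilateCovered_of_card_inter (hA : A.Nonempty) (hK : (#(A + A) : ℝ) ≤ K * #A) (hK₀ : 0 ≤ K)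
    {I : Finset F} (hIA : I ⊆ A) (hIx : I ⊆ A.image (x * ·)) (hI : (#A : ℝ) ≤ 2 * K * #I) :
    DilateCovered (A - A) (4 * K ^ 9) x := by
  have hInon : I.Nonempty := by
    by_contra h
    have hApos : (0 : ℝ) < #A := by exact_mod_cast hA.card_pos
    simp [not_nonempty_iff_eq_empty.1 h] at hI
    simp [hI] at hApos
  have hcard : (#(A.image (x * ·) + I) : ℝ) ≤ 2 * K ^ 2 * #I := by
    have hsub : A.image (x * ·) + I ⊆ (A + A).image (x * ·) := by
      intro z hz
      obtain ⟨u, hu, v, hv, rfl⟩ := mem_add.1 hz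
      obtain ⟨a, ha, rfl⟩ := mem_image.1 hu
      obtain ⟨b, hb, rfl⟩ := mem_image.1 (hIx hv)
      exact mem_image.2 ⟨a + b, add_mem_add ha hb, by ring⟩
    calc (#(A.image (x * ·) + I) : ℝ) ≤ #(A + A) := by
          exact_mod_cast (card_le_card hsub).trans card_image_le
      _ ≤ K * #A := hK
      _ ≤ K * (2 * K * #I) := by gcongr
      _ = _ := by ring
  obtain ⟨X, -, hX, hcov⟩ := ruzsa_covering_add hInon hcard
  obtain ⟨Z, hZ, hZcov⟩ := sumCovered_sub_self hA hK
  refine ⟨X - X + Z, ?_, fun g hg => ?_⟩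
  · calc _ ≤ ((#X * #X * #Z : ℕ) : ℝ) := by
          exact_mod_cast card_add_le.trans (Nat.mul_le_mul_right _ card_sub_le)
      _ = (#X : ℝ) * #X * #Z := by push_cast; rfl
      _ ≤ (2 * K ^ 2) * (2 * K ^ 2) * K ^ 5 := by gcongr
      _ = _ := by ring
  · have hpt : ∀ a ∈ A, ∃ t ∈ X, x * a - t ∈ A - A := by
      intro a ha
      obtain ⟨t, ht, d, hd, htd⟩ := mem_add.1 (hcov (mem_image_of_mem (x * ·) ha))
      exact ⟨t, ht, sub_subset_sub hIA hIA (by rwa [← htd, add_sub_cancel_left])⟩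
    obtain ⟨a, ha, b, hb, rfl⟩ := mem_sub.1 hg
    obtain ⟨s, hs, hs'⟩ := hpt a ha
    obtain ⟨t, ht, ht'⟩ := hpt b hb
    obtain ⟨z, hz, hz'⟩ := hZcov _ hs' _ (neg_mem_sub_self _ ht')
    refine ⟨s - t + z, add_mem_add (sub_mem_sub hs ht) hz, ?_⟩
    convert! hz' using 1
    ring

/-- If `x • (A - A)` is covered by few translates of `A - A`, then `A + x • A` is small. -/
lemma card_add_dilate_le (hA : A.Nonempty) (hK : (#(A + A) : ℝ) ≤ K * #A) (hK₀ : 0 ≤ K)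
    (hx : DilateCovered (A - A) L x) :
    (#((A ×ˢ A).image fun p => p.1 + x * p.2) : ℝ) ≤ L * K ^ 7 * #A := by
  have hL := hx.nonneg
  obtain ⟨X, hX, h⟩ := hx
  obtain ⟨Z, hZ, h'⟩ := sumCovered_sub_self hA hK
  have hdiff : (#(A - A) : ℝ) ≤ K ^ 2 * #A := by
    simpa using card_nsmul_sub_nsmul_le hA hK 1 1
  obtain ⟨a₀, ha₀⟩ := hA
  have hsub : ((A ×ˢ A).image fun p => p.1 + x * p.2) ⊆
      (X + Z + (A - A)).image (· + (a₀ + x * a₀)) := by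
    intro w hw
    obtain ⟨⟨a, b⟩, hab, rfl⟩ := mem_image.1 hw
    obtain ⟨ha, hb⟩ := mem_product.1 hab
    obtain ⟨t, ht, ht'⟩ := h _ (sub_mem_sub hb ha₀)
    obtain ⟨z, hz, hz'⟩ := h' _ (sub_mem_sub ha ha₀) _ ht'
    refine mem_image.2 ⟨_, add_mem_add (add_mem_add ht hz) hz', ?_⟩
    ring
  calc _ ≤ ((#X * #Z * #(A - A) : ℕ) : ℝ) := by
        exact_mod_cast (card_le_card hsub).trans (card_image_le.trans
          (card_add_le.trans (Nat.mul_le_mul_right _ card_add_le)))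
    _ = (#X : ℝ) * #Z * #(A - A) := by push_cast; rfl
    _ ≤ L * K ^ 5 * (K ^ 2 * #A) := by gcongr
    _ = _ := by ring

/-- A set with small sum set and small product set admits many dilates `x` for which `x • (A - A)`
is covered by few translates of `A - A`. -/
lemma exists_many_dilateCovered (hA : A.Nonempty) (hA₀ : 0 ∉ A) (hK₀ : 0 < K)
    (hadd : (#(A + A) : ℝ) ≤ K * #A) (hmul : (#(A * A) : ℝ) ≤ K * #A) :
    ∃ B : Finset F, (#A : ℝ) ≤ 2 * K * #B ∧ ∀ x ∈ B, DilateCovered (A - A) (4 * K ^ 9) x := by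
  have hApos : (0 : ℝ) < #A := by exact_mod_cast hA.card_pos
  set r : F → F → ℕ := fun b a => #{p ∈ A ×ˢ A | a * p.1 = b * p.2} with hr
  have hcount : #{p ∈ (A ×ˢ A) ×ˢ (A ×ˢ A) | p.1.1 * p.1.2 = p.2.1 * p.2.2} =
      ∑ b ∈ A, ∑ a ∈ A, r b a := by
    simp only [hr, card_filter, sum_product]
    refine Eq.trans (sum_congr rfl fun a _ => sum_comm) sum_comm
  clear_value r
  obtain ⟨b, hb, hrb⟩ : ∃ b ∈ A, (#A : ℝ) ^ 2 ≤ K * ∑ a ∈ A, (r b a : ℝ) := by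
    have hcs := card_sq_le_card_image_mul_card_collisions (A ×ˢ A) fun p => p.1 * p.2
    rw [hcount, card_product] at hcs
    have himg : (A ×ˢ A).image (fun p => p.1 * p.2) = A * A := rfl
    rw [himg] at hcs
    have hcs' : ((#A : ℝ) * #A) ^ 2 ≤ #(A * A) * ∑ b ∈ A, ∑ a ∈ A, (r b a : ℝ) := by
      exact_mod_cast hcs
    by_contra! h
    have hlt := sum_lt_sum_of_nonempty hA h
    rw [← mul_sum, sum_const, nsmul_eq_mul] at hlt
    have : ((#A : ℝ) * #A) ^ 2 < ((#A : ℝ) * #A) ^ 2 := by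
      calc _ ≤ #(A * A) * ∑ b ∈ A, ∑ a ∈ A, (r b a : ℝ) := hcs'
        _ ≤ (K * #A) * ∑ b ∈ A, ∑ a ∈ A, (r b a : ℝ) := by gcongr
        _ = #A * (K * ∑ b ∈ A, ∑ a ∈ A, (r b a : ℝ)) := by ring
        _ < #A * (#A * #A ^ 2) := by gcongr
        _ = _ := by ring
    exact lt_irrefl _ this
  have hb₀ : b ≠ 0 := fun h => hA₀ (h ▸ hb)
  have hne : ∀ a ∈ A, a ≠ 0 := fun a ha h => hA₀ (h ▸ ha)
  set I : F → Finset F := fun a => {v ∈ A | v ∈ A.image (a / b * ·)} with hI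
  have hrI : ∀ a ∈ A, r b a ≤ #(I a) := by
    intro a ha
    rw [hr]
    refine card_le_card_of_injOn Prod.snd (fun p hp => ?_) ?_
    · simp only [coe_filter, Set.mem_ofPred_eq, mem_product] at hp
      simp only [hI, coe_filter, Set.mem_ofPred_eq, mem_image]
      refine ⟨hp.1.2, p.1, hp.1.1, ?_⟩
      field_simp
      exact hp.2
    · rintro ⟨p, p'⟩ hp ⟨s, s'⟩ hs rfl
      simp only [coe_filter, Set.mem_ofPred_eq] at hp hs
      exact Prod.ext (mul_left_cancel₀ (hne a ha) (hp.2.trans hs.2.symm)) rfl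
  set T : Finset F := {a ∈ A | (#A : ℝ) ≤ 2 * K * #(I a)}
  refine ⟨T.image (· / b), ?_, ?_⟩
  · rw [card_image_of_injective _ (fun u v h => by simpa [div_left_inj' hb₀] using h)]
    have hbound : ∀ a ∈ A, K * (r b a : ℝ) ≤ #A / 2 + if a ∈ T then K * #A else 0 := by
      intro a ha
      have hra : (r b a : ℝ) ≤ #(I a) := by exact_mod_cast hrI a ha
      split_ifs with h
      · have : K * (r b a : ℝ) ≤ K * #A := by
          gcongr
          exact (hrI a ha).trans (card_filter_le _ _)
        linarith
      · have : 2 * K * #(I a) < (#A : ℝ) := by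
          by_contra! h'
          exact h (mem_filter.2 ⟨ha, h'⟩)
        have : K * (r b a : ℝ) ≤ K * #(I a) := by gcongr
        linarith
    have hTA : T ⊆ A := filter_subset _ _
    have := sum_le_sum hbound
    rw [← mul_sum, sum_add_distrib, sum_ite_mem, inter_eq_right.2 hTA, sum_const, sum_const,
      nsmul_eq_mul, nsmul_eq_mul] at this
    have h2 : (#A : ℝ) * #A ≤ #A * (2 * K * #T) := by nlinarith
    exact le_of_mul_le_mul_left h2 hApos
  · intro x hx
    obtain ⟨a, ha, rfl⟩ := mem_image.1 hx
    exact dilateCovered_of_card_inter hA hadd hK₀.le (I := I a) (filter_subset _ _)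
      (fun v hv => (mem_filter.1 hv).2) (mem_filter.1 ha).2

end Doubling

end Field

/-- In a prime field, some fixed combination `u • B + v • B` of dilates by iterated differences of
`B` is almost as large as possible. -/
lemma exists_dilates_le_card {q : ℕ} [Fact q.Prime] (B : Finset (ZMod q)) (hB : B.Nonempty) :
    ∃ u ∈ B - B, ∃ v ∈ (B - B) + (B - B),
      min (#B ^ 2) q ≤ 2 * #((B ×ˢ B).image fun p => u * p.1 + v * p.2) := by
  obtain ⟨b₀, hb₀⟩ := hB
  have h0 : (0 : ZMod q) ∈ B - B := mem_sub.2 ⟨b₀, hb₀, b₀, hb₀, sub_self _⟩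
  rcases le_or_gt #B 1 with h1 | h1
  · refine ⟨0, h0, 0, mem_add.2 ⟨0, h0, 0, h0, add_zero _⟩, ?_⟩
    have hne : ((B ×ˢ B).image fun p => (0 : ZMod q) * p.1 + 0 * p.2).Nonempty :=
      ⟨_, mem_image_of_mem _ (mk_mem_product hb₀ hb₀)⟩
    have := hne.card_pos
    have : #B ^ 2 ≤ 1 := pow_le_one' h1 2
    omega
  by_cases hQ : ∀ ξ : ZMod q, ∃ u ∈ B - B, u ≠ 0 ∧ u * ξ ∈ B - B
  · obtain ⟨ξ, -, hξ⟩ := exists_le_card_add_dilate univ B univ_nonempty ⟨b₀, hb₀⟩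
    obtain ⟨u, hu, hu₀, hv⟩ := hQ ξ
    refine ⟨u, hu, u * ξ, mem_add.2 ⟨_, hv, 0, h0, add_zero _⟩, ?_⟩
    rw [card_univ, ZMod.card] at hξ
    refine hξ.trans_eq ?_
    rw [← card_image_of_injective _ (mul_right_injective₀ hu₀), image_image]
    refine congrArg (fun f => 2 * #(image f (B ×ˢ B))) (funext fun p => ?_)
    simp only [Function.comp]
    ring
  · obtain ⟨ξ, ⟨u, hu, hu₀, huξ⟩, hξ⟩ : ∃ ξ : ZMod q, (∃ u ∈ B - B, u ≠ 0 ∧ u * ξ ∈ B - B) ∧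
        ∀ u ∈ B - B, u ≠ 0 → u * (ξ + 1) ∉ B - B := by
      by_contra! hstep
      refine hQ fun ξ => ?_
      rw [← ZMod.natCast_zmod_val ξ]
      induction ξ.val with
      | zero =>
        obtain ⟨c, hc, d, hd, hcd⟩ := one_lt_card.1 h1
        exact ⟨c - d, sub_mem_sub hc hd, sub_ne_zero.2 hcd, by simpa using h0⟩
      | succ n ih => simpa using hstep _ ih
    refine ⟨u, hu, u * ξ + u, add_mem_add huξ hu, ?_⟩
    rw [card_image_of_injOn, card_product]
    · have := min_le_left (#B ^ 2) q
      nlinarith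
    · rintro ⟨a, b⟩ hab ⟨c, d⟩ hcd h
      simp only [coe_product, Set.mem_prod, mem_coe] at hab hcd h
      have hac : a - c = (d - b) * (ξ + 1) := by
        refine mul_left_cancel₀ hu₀ ?_
        linear_combination h
      have hdb : d - b = 0 := by
        by_contra hne
        exact hξ _ (sub_mem_sub hcd.2 hab.2) hne (hac ▸ sub_mem_sub hab.1 hcd.1)
      rw [hdb, zero_mul] at hac
      exact Prod.ext (sub_eq_zero.1 hac) (sub_eq_zero.1 hdb).symm

/-- A quantitative sum-product inequality: if both `A + A` and `A * A` have size at most `K * #A`,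
then `K` is large unless `A` is nearly everything. -/
lemma min_sq_card_le_of_card_add_mul_le {q : ℕ} [Fact q.Prime] {A : Finset (ZMod q)} {K : ℝ}
    (hA : A.Nonempty) (hA₀ : 0 ∉ A) (hK : 1 ≤ K)
    (hadd : (#(A + A) : ℝ) ≤ K * #A) (hmul : (#(A * A) : ℝ) ≤ K * #A) :
    min ((#A : ℝ) ^ 2) q ≤ 4 ^ 10 * K ^ 106 * #A := by
  have hK₀ : 0 < K := by linarith
  have hApos : (0 : ℝ) < #A := by exact_mod_cast hA.card_pos
  obtain ⟨B, hBcard, hB⟩ := exists_many_dilateCovered hA hA₀ hK₀ hadd hmul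
  have hBne : B.Nonempty := by
    by_contra h
    simp only [not_nonempty_iff_eq_empty.1 h, card_empty, Nat.cast_zero, mul_zero] at hBcard
    linarith
  obtain ⟨u, hu, v, hv, hS⟩ := exists_dilates_le_card B hBne
  set S := (B ×ˢ B).image fun p => u * p.1 + v * p.2
  obtain ⟨x, hx, hxcard⟩ := exists_le_card_add_dilate S A ((hBne.product hBne).image _) hA
  have hsum := sumCovered_sub_self hA hadd
  have hdiff : ∀ w ∈ B - B,
      DilateCovered (A - A) (4 * K ^ 9 * (4 * K ^ 9) * K ^ 5) w := by
    intro w hw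
    obtain ⟨a, ha, b, hb, rfl⟩ := mem_sub.1 hw
    exact (hB a ha).sub hsum neg_mem_sub_self (hB b hb)
  obtain ⟨v₁, hv₁, v₂, hv₂, rfl⟩ := mem_add.1 hv
  obtain ⟨⟨b, b'⟩, hbb, rfl⟩ := mem_image.1 hx
  obtain ⟨hb, hb'⟩ := mem_product.1 hbb
  have hxcov := ((hdiff u hu).mul (hB b hb)).add hsum
    (((hdiff v₁ hv₁).add hsum (hdiff v₂ hv₂)).mul (hB b' hb'))
  have hupper := card_add_dilate_le hA hadd hK₀.le hxcov
  set m := #((A ×ˢ A).image fun p => p.1 + (u * b + (v₁ + v₂) * b') * p.2)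
  have hm : (m : ℝ) ≤ 4 ^ 8 * K ^ 104 * #A := hupper.trans_eq (by ring)
  have hK2 : 1 ≤ K ^ 2 := one_le_pow₀ hK
  have hAB : (#A : ℝ) ^ 2 ≤ 4 * K ^ 2 * #B ^ 2 := by
    calc (#A : ℝ) ^ 2 ≤ (2 * K * #B) ^ 2 := by gcongr
      _ = _ := by ring
  have hmain : min ((#A : ℝ) ^ 2) q ≤ 16 * K ^ 2 * m := by
    have hm₀ : (0 : ℝ) ≤ m := Nat.cast_nonneg _
    have hm₁ : (m : ℝ) ≤ K ^ 2 * m := le_mul_of_one_le_left hm₀ hK2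
    rcases min_le_iff.1 hxcard with h | h
    · have h' : (#A : ℝ) ^ 2 ≤ 2 * m := by exact_mod_cast h
      exact (min_le_left _ _).trans (by linarith)
    · have h' : (#S : ℝ) ≤ 2 * m := by exact_mod_cast h
      rcases min_le_iff.1 hS with hS | hS
      · have hS' : (#B : ℝ) ^ 2 ≤ 2 * #S := by exact_mod_cast hS
        refine (min_le_left _ _).trans (hAB.trans ?_)
        calc 4 * K ^ 2 * (#B : ℝ) ^ 2 ≤ 4 * K ^ 2 * (2 * (2 * m)) := by
              gcongr
              linarith
          _ = _ := by ring
      · have hS' : (q : ℝ) ≤ 2 * #S := by exact_mod_cast hS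
        exact (min_le_right _ _).trans (by linarith)
  calc _ ≤ 16 * K ^ 2 * m := hmain
    _ ≤ 16 * K ^ 2 * (4 ^ 8 * K ^ 104 * #A) := by gcongr
    _ = _ := by ring

/-- The sum-product estimate for sets of nonzero elements. -/
lemma sum_product_estimate_of_zero_notMem {δ : ℝ} (hδ : 0 < δ) (hδ₁ : δ < 1) {q : ℕ}
    [Fact q.Prime] {A : Finset (ZMod q)} (hA : A.Nonempty) (hA₀ : 0 ∉ A)
    (hcard : (#A : ℝ) < (q : ℝ) ^ (1 - δ)) :
    (4 ^ 10)⁻¹ * (#A : ℝ) ^ (1 + δ / 106) ≤ (max #(A + A) #(A * A) : ℕ) := by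
  have hApos : (0 : ℝ) < #A := by exact_mod_cast hA.card_pos
  have hA₁ : (1 : ℝ) ≤ #A := by exact_mod_cast hA.card_pos
  obtain ⟨K, hK⟩ : ∃ K : ℝ, K * #A = (max #(A + A) #(A * A) : ℕ) :=
    ⟨_, div_mul_cancel₀ _ hApos.ne'⟩
  have hadd : (#(A + A) : ℝ) ≤ K * #A := by
    rw [hK]
    exact_mod_cast le_max_left _ _
  have hmul : (#(A * A) : ℝ) ≤ K * #A := by
    rw [hK]
    exact_mod_cast le_max_right _ _
  have hK₁ : 1 ≤ K := by
    have h : (#A : ℝ) ≤ #(A + A) := by exact_mod_cast card_le_card_add_right hA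
    exact le_of_mul_le_mul_right (by linarith) hApos
  have hlow : (#A : ℝ) ^ (1 + δ) ≤ min ((#A : ℝ) ^ 2) q := by
    refine le_min ?_ ?_
    · rw [← Real.rpow_natCast]
      exact Real.rpow_le_rpow_of_exponent_le hA₁ (by push_cast; linarith)
    · have hq : (1 : ℝ) ≤ q := by exact_mod_cast (Fact.out : q.Prime).one_le
      calc (#A : ℝ) ^ (1 + δ) ≤ ((q : ℝ) ^ (1 - δ)) ^ (1 + δ) := by gcongr
        _ = (q : ℝ) ^ ((1 - δ) * (1 + δ)) := by rw [← Real.rpow_mul (by positivity)]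
        _ ≤ (q : ℝ) ^ (1 : ℝ) := Real.rpow_le_rpow_of_exponent_le hq (by nlinarith)
        _ = q := Real.rpow_one _
  have hKpow : (#A : ℝ) ^ δ ≤ 4 ^ 10 * K ^ 106 := by
    refine le_of_mul_le_mul_left ?_ hApos
    calc (#A : ℝ) * (#A : ℝ) ^ δ = (#A : ℝ) ^ (1 + δ) := by
          rw [Real.rpow_add hApos, Real.rpow_one]
      _ ≤ 4 ^ 10 * K ^ 106 * #A :=
          hlow.trans (min_sq_card_le_of_card_add_mul_le hA hA₀ hK₁ hadd hmul)
      _ = _ := by ring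
  have hroot : (4 ^ 10)⁻¹ * (#A : ℝ) ^ (δ / 106) ≤ K := by
    refine le_of_pow_le_pow_left₀ (n := 106) (by norm_num) (by linarith) ?_
    have hpow : ((#A : ℝ) ^ (δ / 106)) ^ 106 = (#A : ℝ) ^ δ := by
      rw [← Real.rpow_natCast, ← Real.rpow_mul hApos.le]
      congr 1
      push_cast
      ring
    calc ((4 ^ 10)⁻¹ * (#A : ℝ) ^ (δ / 106)) ^ 106 = ((4 ^ 10)⁻¹) ^ 106 * (#A : ℝ) ^ δ := by
          rw [mul_pow, hpow]
      _ ≤ (4 ^ 10)⁻¹ * (4 ^ 10 * K ^ 106) := by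
          gcongr
          exact pow_le_of_le_one (by positivity) (by norm_num) (by norm_num)
      _ = K ^ 106 := by rw [inv_mul_cancel_left₀ (by positivity)]
  calc (4 ^ 10)⁻¹ * (#A : ℝ) ^ (1 + δ / 106) = (4 ^ 10)⁻¹ * (#A : ℝ) ^ (δ / 106) * #A := by
        rw [Real.rpow_add hApos, Real.rpow_one]
        ring
    _ ≤ K * #A := by gcongr
    _ = _ := hK

/-- **Corollary 1 (Konyagin).** For every `δ > 0` there exist `ε = ε(δ) > 0` and
`c(δ) > 0` such that for every prime `q` and every nonempty subset `A` of
`F = ℤ/qℤ` with `|A| < |F|^(1-δ)`, one has `max (|A+A|, |A·A|) ≥ c(δ) * |A|^(1+ε)`. -/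
theorem sum_product_estimate_of_card_lt :
    ∀ δ > (0 : ℝ), ∃ ε > (0 : ℝ), ∃ c > (0 : ℝ), ∀ q : ℕ, q.Prime →
      ∀ A : Finset (ZMod q), A.Nonempty → (A.card : ℝ) < (q : ℝ) ^ ((1 : ℝ) - δ) →
        c * (A.card : ℝ) ^ (1 + ε) ≤ ((max (A + A).card (A * A).card : ℕ) : ℝ) := by
  intro δ hδ
  refine ⟨δ / 106, by positivity, (4 ^ 12)⁻¹, by positivity, fun q hq A hA hcard => ?_⟩
  have : Fact q.Prime := ⟨hq⟩
  have hA₁ : (1 : ℝ) ≤ #A := by exact_mod_cast hA.card_pos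
  have hδ₁ : δ < 1 := by
    by_contra! h
    have : (q : ℝ) ^ (1 - δ) ≤ 1 :=
      Real.rpow_le_one_of_one_le_of_nonpos (by exact_mod_cast hq.one_le) (by linarith)
    linarith
  have hmax : 1 ≤ max #(A + A) #(A * A) := (hA.add hA).card_pos.trans_le (le_max_left _ _)
  rcases (A.erase 0).eq_empty_or_nonempty with hE | hE
  · have h1 : #A ≤ 1 := by
      have := pred_card_le_card_erase (s := A) (a := 0)
      rw [hE, card_empty] at this
      omega
    have h1' : #A = 1 := le_antisymm h1 hA.card_pos
    rw [h1', Nat.cast_one, Real.one_rpow, mul_one]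
    calc ((4 ^ 12)⁻¹ : ℝ) ≤ 1 := by norm_num
      _ ≤ _ := by exact_mod_cast hmax
  · have hsub : A.erase 0 ⊆ A := erase_subset _ _
    have hle : (#(A.erase 0) : ℝ) ≤ #A := by exact_mod_cast card_le_card hsub
    have h2 : (#A : ℝ) ≤ 2 * #(A.erase 0) := by
      have := pred_card_le_card_erase (s := A) (a := 0)
      have := hE.card_pos
      exact_mod_cast (by omega : #A ≤ 2 * #(A.erase 0))
    have key := sum_product_estimate_of_zero_notMem hδ hδ₁ hE (notMem_erase 0 A)
      (hle.trans_lt hcard)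
    have htwo : (2 : ℝ) ^ (1 + δ / 106) ≤ 4 := by
      calc (2 : ℝ) ^ (1 + δ / 106) ≤ 2 ^ (2 : ℝ) :=
            Real.rpow_le_rpow_of_exponent_le (by norm_num) (by linarith)
        _ = 4 := by norm_num
    calc (4 ^ 12)⁻¹ * (#A : ℝ) ^ (1 + δ / 106)
        ≤ (4 ^ 12)⁻¹ * (2 * #(A.erase 0) : ℝ) ^ (1 + δ / 106) := by gcongr
      _ = (4 ^ 12)⁻¹ * (2 ^ (1 + δ / 106) * (#(A.erase 0) : ℝ) ^ (1 + δ / 106)) := by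
          rw [Real.mul_rpow (by norm_num) (by positivity)]
      _ ≤ (4 ^ 12)⁻¹ * (4 * (#(A.erase 0) : ℝ) ^ (1 + δ / 106)) := by gcongr
      _ ≤ (4 ^ 10)⁻¹ * (#(A.erase 0) : ℝ) ^ (1 + δ / 106) := by
          rw [← mul_assoc]
          gcongr
          norm_num
      _ ≤ _ := key
      _ ≤ _ := by
          exact_mod_cast max_le_max (card_le_card (add_subset_add hsub hsub))
            (card_le_card (mul_subset_mul hsub hsub))
end

section
/- There exists an absolute constant c > 0 such that the following holds: let q be a prime, F = ℤ/qℤ, let G be a multiplicative subgroup of F* = F \ {0}, and let B be a nonempty subset of G with |B| < |F|^{1/2}. Then |B−B| ≥ c·|B|^{5/2}/|G|. -/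
open scoped Pointwise
open Polynomial

/-- A polynomial over a field of characteristic `q` with degree below `q` and at most `N` terms
cannot vanish to order `N` at `1`, unless it is zero. -/
theorem eq_zero_of_one_sub_X_pow_dvd {F : Type*} [Field F] {q : ℕ} [CharP F q] (N : ℕ) (f : F[X])
    (hN : f.support.card ≤ N) (hq : f.degree < q) (hdvd : (1 - X) ^ N ∣ f) : f = 0 := by
  induction N generalizing f with
  | zero => simpa using hN
  | succ N ih =>
    by_contra hf
    set e := f.natDegree with he
    have heq : e < q := (natDegree_lt_iff_degree_lt hf).2 hq
    set g : F[X] := X * derivative f - C (e : F) * f with hg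
    have hcoeff (i : ℕ) : g.coeff i = ((i : F) - e) * f.coeff i := by
      rcases i with _ | i
      · simp [hg]
      · simp [hg, coeff_X_mul, coeff_derivative]; ring
    have hsupp : g.support ⊆ f.support.erase e := by
      intro i hi
      rw [mem_support_iff, hcoeff] at hi
      rw [Finset.mem_erase, mem_support_iff]
      refine ⟨?_, right_ne_zero_of_mul hi⟩
      rintro rfl
      simp at hi
    have hmem : e ∈ f.support := natDegree_mem_support_of_nonzero hf
    have hg0 : g = 0 := by
      refine ih g ?_ ?_ ?_
      · have := Finset.card_le_card hsupp
        rw [Finset.card_erase_of_mem hmem] at this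
        omega
      · refine lt_of_le_of_lt ?_ hq
        exact Finset.max_mono (hsupp.trans (Finset.erase_subset _ _))
      · obtain ⟨h, rfl⟩ := hdvd
        refine dvd_sub (Dvd.dvd.mul_left ?_ _) (Dvd.dvd.mul_left ?_ _)
        · rw [derivative_mul, derivative_pow_succ]
          exact dvd_add ⟨C ((N : F) + 1) * derivative (1 - X) * h, by ring⟩
            ⟨(1 - X) * derivative h, by ring⟩
        · exact ⟨(1 - X) * h, by ring⟩
    have hlow (i : ℕ) (hi : i ≠ e) : f.coeff i = 0 := by
      by_cases hie : e < i
      · exact coeff_eq_zero_of_natDegree_lt hie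
      have h0 := hcoeff i
      rw [hg0, coeff_zero, eq_comm, mul_eq_zero, sub_eq_zero] at h0
      refine h0.resolve_left fun h => hi ?_
      exact CharP.natCast_injOn_Iio F q (by simp; omega) heq h
    have hfm : f = monomial e (f.coeff e) := by
      ext i
      rw [coeff_monomial]
      split_ifs with h
      · rw [h]
      · exact hlow i (Ne.symm h)
    have h1 : f.eval 1 = 0 := by
      obtain ⟨h, rfl⟩ := hdvd
      simp
    rw [hfm] at h1
    simp only [eval_monomial, one_pow, mul_one] at h1
    exact mem_support_iff.1 hmem h1

/-- Expansions in powers of `M` are unique when the digits range over a set of polynomials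
containing no nonzero multiple of `M`. -/
theorem digits_eq_zero_of_sum_pow_mul_eq_zero {F : Type*} [Field F] {M : F[X]} (hM : M ≠ 0)
    {P : F[X] → Prop} (hP : ∀ f, P f → M ∣ f → f = 0) {N : ℕ} (f : Fin N → F[X])
    (hf : ∀ i, P (f i)) (hsum : ∑ i : Fin N, M ^ (i : ℕ) * f i = 0) (i : Fin N) : f i = 0 := by
  induction N with
  | zero => exact i.elim0
  | succ N ih =>
    simp only [Fin.sum_univ_succ, Fin.val_zero, pow_zero, one_mul, Fin.val_succ, pow_succ',
      mul_assoc, ← Finset.mul_sum] at hsum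
    have h0 : f 0 = 0 := by
      refine hP _ (hf 0) ?_
      rw [eq_neg_of_add_eq_zero_left hsum]
      exact (dvd_mul_right _ _).neg_right
    refine Fin.cases h0 (fun j => ?_) i
    rw [h0, zero_add, mul_eq_zero, or_iff_right hM] at hsum
    exact ih (fun j => f j.succ) (fun j => hf _) hsum j

/-- The derivation `X (1 - X) d/dX`. -/
noncomputable def eulerDeriv (F : Type*) [Field F] : F[X] →ₗ[F] F[X] :=
  LinearMap.mulLeft F (X * (1 - X)) ∘ₗ derivative

/-- The conjugate of `eulerDeriv` by `X ^ s * (1 - X) ^ t`. -/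
noncomputable def twistedDeriv (F : Type*) [Field F] (s t : ℕ) : F[X] →ₗ[F] F[X] :=
  LinearMap.mulLeft F (C (s : F) * (1 - X) - C (t : F) * X) + eulerDeriv F

theorem eulerDeriv_pow_mul {F : Type*} [Field F] (s t : ℕ) (f : F[X]) :
    eulerDeriv F (X ^ s * (1 - X) ^ t * f) = X ^ s * (1 - X) ^ t * twistedDeriv F s t f := by
  rcases s with _ | s <;> rcases t with _ | t <;>
  simp [eulerDeriv, twistedDeriv, derivative_pow_succ] <;> ring

theorem eulerDeriv_iterate_pow_mul {F : Type*} [Field F] (s t m : ℕ) (f : F[X]) :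
    (eulerDeriv F ^ m) (X ^ s * (1 - X) ^ t * f) =
      X ^ s * (1 - X) ^ t * (twistedDeriv F s t ^ m) f := by
  induction m generalizing f with
  | zero => simp
  | succ m ih => rw [pow_succ, pow_succ, Module.End.mul_apply, Module.End.mul_apply,
      eulerDeriv_pow_mul, ih]

theorem twistedDeriv_mem_degreeLT {F : Type*} [Field F] (s t : ℕ) {N : ℕ} {f : F[X]}
    (hf : f ∈ degreeLT F N) : twistedDeriv F s t f ∈ degreeLT F (N + 1) := by
  rw [mem_degreeLT] at *
  by_cases h0 : f = 0
  · simp [h0]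
  have hN : f.natDegree < N := (natDegree_lt_iff_degree_lt h0).2 hf
  refine lt_of_le_of_lt (b := ((f.natDegree + 1 : ℕ) : WithBot ℕ)) ?_ (by exact_mod_cast by omega)
  apply degree_le_of_natDegree_le
  simp only [twistedDeriv, eulerDeriv, LinearMap.add_apply, LinearMap.mulLeft_apply,
    LinearMap.comp_apply]
  refine natDegree_add_le_of_degree_le ?_ ?_
  · refine natDegree_mul_le.trans ?_
    have : (C (s : F) * (1 - X) - C (t : F) * X).natDegree ≤ 1 := by compute_degree
    omega
  · by_cases hd : f.natDegree = 0
    · rw [natDegree_eq_zero.1 hd |>.choose_spec.symm]; simp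
    refine natDegree_mul_le.trans ?_
    have : (X * (1 - X) : F[X]).natDegree ≤ 2 := by compute_degree
    have := natDegree_derivative_lt hd
    omega

theorem twistedDeriv_iterate_mem_degreeLT {F : Type*} [Field F] (s t m : ℕ) {N : ℕ} {f : F[X]}
    (hf : f ∈ degreeLT F N) : (twistedDeriv F s t ^ m) f ∈ degreeLT F (N + m) := by
  induction m with
  | zero => simpa
  | succ m ih =>
    rw [pow_succ', Module.End.mul_apply]
    exact twistedDeriv_mem_degreeLT s t ih

/-- If the first `m` iterates of `X (1 - X) d/dX` on `f` vanish at `u ≠ 0, 1`, then `f` vanishes at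
`u` to order `m`, as long as `m` does not exceed the characteristic. -/
theorem X_sub_C_pow_dvd_of_eulerDeriv {F : Type*} [Field F] {q : ℕ} [CharP F q] {u : F}
    (hu0 : u ≠ 0) (hu1 : u ≠ 1) (m : ℕ) (hm : m ≤ q) (f : F[X])
    (hf : ∀ i < m, ((eulerDeriv F ^ i) f).eval u = 0) : (X - C u) ^ m ∣ f := by
  induction m generalizing f with
  | zero => simp
  | succ m ih =>
    have h1 : (X - C u) ^ m ∣ eulerDeriv F f := by
      refine ih (by omega) _ fun i hi => ?_
      have := hf (i + 1) (by omega)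
      rwa [pow_succ, Module.End.mul_apply] at this
    have h2 : (X - C u) ^ m ∣ derivative f := by
      have hcop : IsCoprime (X - C u) (X * (1 - X)) := by
        refine (irreducible_X_sub_C u).coprime_iff_not_dvd.2 fun h => ?_
        rw [dvd_iff_isRoot] at h
        simp [sub_eq_zero, hu0, Ne.symm hu1] at h
      exact hcop.pow_left.dvd_of_dvd_mul_left h1
    have h3 : f.IsRoot u := by simpa using hf 0 (by omega)
    by_cases h0 : f = 0
    · simp [h0]
    rw [← le_rootMultiplicity_iff h0]
    by_contra hlt
    set r := f.rootMultiplicity u with hr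
    have hr0 : 0 < r := (rootMultiplicity_pos h0).2 h3
    have hrF : (r : F) ≠ 0 := by
      rw [Ne, CharP.cast_eq_zero_iff F q]
      exact fun h => absurd (Nat.le_of_dvd hr0 h) (by omega)
    have h4 := derivative_rootMultiplicity_of_root_of_mem_nonZeroDivisors h3
      (mem_nonZeroDivisors_of_ne_zero hrF)
    have h5 : derivative f ≠ 0 := by
      intro hd
      obtain ⟨g, hg⟩ := f.exists_eq_pow_rootMultiplicity_mul_and_not_dvd h0 u
      rw [← hr] at hg
      obtain ⟨s, hs⟩ : ∃ s, r = s + 1 := ⟨r - 1, by omega⟩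
      rw [hs] at hg hrF
      rw [hg.1, derivative_mul, derivative_pow_succ] at hd
      have : (X - C u) ^ s * (C ((s : F) + 1) * g + (X - C u) * derivative g) = 0 := by
        rw [← hd]; simp; ring
      have := (mul_eq_zero.1 this).resolve_left (pow_ne_zero _ (X_sub_C_ne_zero u))
      apply hg.2
      have hd : (X - C u) ∣ C ((s : F) + 1) * g :=
        ⟨- derivative g, by linear_combination this⟩
      rwa [dvd_C_mul (by exact_mod_cast hrF)] at hd
    have := (le_rootMultiplicity_iff h5).2 h2
    omega

/-- The generalized power sum attached to a family of polynomials of degree below `A`. -/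
noncomputable def auxPoly {F : Type*} [Field F] (n : ℕ) {A b : ℕ}
    (f : Fin b × Fin b → degreeLT F A) : F[X] :=
  ∑ j : Fin b × Fin b, X ^ (n * (j.1 : ℕ)) * (1 - X) ^ (n * (j.2 : ℕ)) * (f j : F[X])

theorem natDegree_auxPoly_lt {F : Type*} [Field F] {n A b : ℕ} (hb : 0 < b) (hn : 0 < n)
    (hA : A ≤ n) (f : Fin b × Fin b → degreeLT F A) : (auxPoly n f).natDegree < 2 * n * b := by
  obtain ⟨c, rfl⟩ : ∃ c, b = c + 1 := ⟨b - 1, by omega⟩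
  refine lt_of_le_of_lt (natDegree_sum_le_of_forall_le (n := 2 * n * c + (n - 1)) _ _ ?_) ?_
  · rintro ⟨i, j⟩ -
    have hi : n * (i : ℕ) ≤ n * c := Nat.mul_le_mul_left n (by omega)
    have hj : n * (j : ℕ) ≤ n * c := Nat.mul_le_mul_left n (by omega)
    have h1 : (X ^ (n * (i : ℕ)) : F[X]).natDegree ≤ n * c := by simpa using hi
    have h2 : ((1 - X) ^ (n * (j : ℕ)) : F[X]).natDegree ≤ n * c := by
      refine natDegree_pow_le.trans ?_
      have : (1 - X : F[X]).natDegree ≤ 1 := by compute_degree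
      nlinarith
    have h3 : (f (i, j) : F[X]).natDegree ≤ n - 1 := by
      have := mem_degreeLT.1 (f (i, j)).2
      by_cases h0 : (f (i, j) : F[X]) = 0
      · simp [h0]
      · have := (natDegree_lt_iff_degree_lt h0).2 this
        omega
    refine natDegree_mul_le.trans ?_
    have h4 := natDegree_mul_le (p := (X ^ (n * (i : ℕ)) : F[X])) (q := (1 - X) ^ (n * (j : ℕ)))
    dsimp only
    nlinarith
  · rw [Nat.mul_add, mul_one]
    omega

theorem eq_zero_of_auxPoly_eq_zero {F : Type*} [Field F] {q : ℕ} [CharP F q] {n A b : ℕ}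
    (hA : A ≤ n) (hAb : A * b ≤ n) (hnb : n * b ≤ q) (f : Fin b × Fin b → degreeLT F A)
    (hf : auxPoly n f = 0) : f = 0 := by
  have hinner (j : Fin b) : ∑ i : Fin b, (X ^ n) ^ (i : ℕ) * (f (i, j) : F[X]) = 0 := by
    refine digits_eq_zero_of_sum_pow_mul_eq_zero (M := (1 - X) ^ n)
      (P := fun g => g.support.card ≤ n ∧ g.degree < q) ?_ ?_
      (fun j : Fin b => ∑ i : Fin b, (X ^ n) ^ (i : ℕ) * (f (i, j) : F[X])) ?_ ?_ j
    · refine pow_ne_zero _ fun h => ?_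
      simpa using congrArg (eval 0) h
    · exact fun g hg hdvd => eq_zero_of_one_sub_X_pow_dvd n g hg.1 hg.2 hdvd
    · intro j
      constructor
      · refine le_trans (Finset.card_le_card (t := Finset.univ.biUnion fun i : Fin b =>
          ((X ^ n) ^ (i : ℕ) * (f (i, j) : F[X])).support) ?_) ?_
        · intro e he
          rw [mem_support_iff, finsetSum_coeff] at he
          obtain ⟨i, -, hi⟩ := Finset.exists_ne_zero_of_sum_ne_zero he
          exact Finset.mem_biUnion.2 ⟨i, Finset.mem_univ _, mem_support_iff.2 hi⟩
        · refine (Finset.card_biUnion_le_card_mul _ _ A fun i _ => ?_).trans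
            (by simpa [mul_comm] using hAb)
          have hsub : ((X ^ n) ^ (i : ℕ) * (f (i, j) : F[X])).support ⊆
              (Finset.range A).image (· + n * i) := by
            intro e he
            rw [mem_support_iff, ← pow_mul, coeff_X_pow_mul'] at he
            split_ifs at he with h
            · refine Finset.mem_image.2 ⟨e - n * i, ?_, by omega⟩
              by_contra hlt
              rw [Finset.mem_range, not_lt] at hlt
              refine he (coeff_eq_zero_of_degree_lt ?_)
              exact (mem_degreeLT.1 (f (i, j)).2).trans_le (by exact_mod_cast hlt)
            · exact absurd rfl he
          exact (Finset.card_le_card hsub).trans (Finset.card_image_le.trans (by simp))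
      · rw [degree_lt_iff_coeff_zero]
        intro e he
        rw [finsetSum_coeff]
        refine Finset.sum_eq_zero fun i _ => ?_
        rw [← pow_mul, coeff_X_pow_mul']
        split_ifs with h
        · refine coeff_eq_zero_of_degree_lt ((mem_degreeLT.1 (f (i, j)).2).trans_le ?_)
          have : n * ((i : ℕ) + 1) ≤ n * b := Nat.mul_le_mul_left n (by omega)
          rw [Nat.mul_add] at this
          exact_mod_cast (by omega : A ≤ e - n * i)
        · rfl
    · rw [← hf, auxPoly, Fintype.sum_prod_type_right]
      refine Finset.sum_congr rfl fun j _ => ?_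
      rw [Finset.mul_sum]
      refine Finset.sum_congr rfl fun i _ => ?_
      rw [pow_mul, pow_mul]
      ring
  funext ⟨i, j⟩
  refine Subtype.ext ?_
  refine digits_eq_zero_of_sum_pow_mul_eq_zero (M := X ^ n) (P := fun g => g.degree < n)
    (pow_ne_zero _ X_ne_zero) ?_ (fun i : Fin b => (f (i, j) : F[X])) ?_ (hinner j) i
  · intro g hg hdvd
    exact eq_zero_of_dvd_of_degree_lt hdvd (by simpa using hg)
  · exact fun i => (mem_degreeLT.1 (f (i, j)).2).trans_le (by exact_mod_cast hA)

/-- There is a nonzero choice of coefficients for which all iterated derivatives of order less than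
`A` vanish as soon as `u ^ n = 1` and `(1 - u) ^ n ∈ Y`. -/
theorem exists_auxPoly_eulerDeriv_eval_eq_zero {F : Type*} [Field F] (n A b : ℕ) (hA : 0 < A)
    (Y : Finset F) (hY : 2 * Y.card * A < b ^ 2) :
    ∃ f : Fin b × Fin b → degreeLT F A, f ≠ 0 ∧ ∀ u : F, u ^ n = 1 → (1 - u) ^ n ∈ Y →
      ∀ m < A, ((eulerDeriv F ^ m) (auxPoly n f)).eval u = 0 := by
  let Q (y : F) (m : ℕ) : (Fin b × Fin b → degreeLT F A) →ₗ[F] F[X] :=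
    ∑ j : Fin b × Fin b, y ^ (j.2 : ℕ) • ((twistedDeriv F (n * j.1) (n * j.2) ^ m) ∘ₗ
      (degreeLT F A).subtype ∘ₗ LinearMap.proj (φ := fun _ => degreeLT F A) j)
  have hQ (y : F) (m : ℕ) (f : Fin b × Fin b → degreeLT F A) : Q y m f =
      ∑ j : Fin b × Fin b, y ^ (j.2 : ℕ) • (twistedDeriv F (n * j.1) (n * j.2) ^ m) (f j) := by
    simp [Q, LinearMap.sum_apply]
  let L : (Fin b × Fin b → degreeLT F A) →ₗ[F] (Y × Fin A × Fin (A + A) → F) :=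
    LinearMap.pi fun j => lcoeff F j.2.2 ∘ₗ Q j.1 j.2.1
  have hker : LinearMap.ker L ≠ ⊥ := by
    apply LinearMap.ker_ne_bot_of_finrank_lt
    rw [Module.finrank_fintype_fun_eq_card, Module.finrank_pi_fintype]
    have : Module.finrank F (degreeLT F A) = A := by
      rw [(degreeLTEquiv F A).finrank_eq]; simp
    simp only [this, Finset.sum_const, Finset.card_univ, Fintype.card_prod, Fintype.card_fin,
      Fintype.card_coe, smul_eq_mul]
    nlinarith
  obtain ⟨f, hf, hf0⟩ := (Submodule.ne_bot_iff _).1 hker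
  refine ⟨f, hf0, fun u hu huY m hm => ?_⟩
  have hQ0 : Q ((1 - u) ^ n) m f = 0 := by
    have hdeg : Q ((1 - u) ^ n) m f ∈ degreeLT F (A + A) := by
      rw [hQ]
      refine Submodule.sum_mem _ fun j _ => Submodule.smul_mem _ _ ?_
      exact degreeLT_mono (by omega) (twistedDeriv_iterate_mem_degreeLT _ _ m (f j).2)
    ext e
    by_cases he : e < A + A
    · exact congrFun (LinearMap.mem_ker.1 hf) (⟨_, huY⟩, ⟨m, hm⟩, ⟨e, he⟩)
    · exact coeff_eq_zero_of_degree_lt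
        ((mem_degreeLT.1 hdeg).trans_le (by exact_mod_cast not_lt.1 he))
  rw [← eval_zero (x := u), ← hQ0, hQ, auxPoly, map_sum, eval_finsetSum, eval_finsetSum]
  refine Finset.sum_congr rfl fun j _ => ?_
  rw [eulerDeriv_iterate_pow_mul]
  simp [pow_mul, hu]

/-- **Stepanov's method**: a bound for the number of `n`-th roots of unity `u ≠ 1` for which
`(1 - u) ^ n` lies in a given set. -/
theorem mul_card_le_of_pow_eq_one_of_one_sub_pow_mem {F : Type*} [Field F] {q : ℕ} [CharP F q]
    {n A b : ℕ} (hA : 0 < A) (hn : 0 < n) (hAb : A * b ≤ n) (hnb : n * b ≤ q) (Y U : Finset F)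
    (hY : 2 * Y.card * A < b ^ 2)
    (hU : ∀ u ∈ U, u ^ n = 1 ∧ u ≠ 1 ∧ (1 - u) ^ n ∈ Y) : A * U.card ≤ 2 * n * b := by
  have hb : 0 < b := by
    rcases Nat.eq_zero_or_pos b with rfl | h
    · simp at hY
    · exact h
  have hAn : A ≤ n := le_trans (Nat.le_mul_of_pos_right A hb) hAb
  have hAq : A ≤ q := hAn.trans (le_trans (Nat.le_mul_of_pos_right n hb) hnb)
  obtain ⟨f, hf0, hf⟩ := exists_auxPoly_eulerDeriv_eval_eq_zero n A b hA Y hY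
  have hne : auxPoly n f ≠ 0 := fun h => hf0 (eq_zero_of_auxPoly_eq_zero hAn hAb hnb f h)
  have hdvd : ∏ u ∈ U, (X - C u) ^ A ∣ auxPoly n f := by
    refine Finset.prod_dvd_of_coprime ?_ fun u hu => ?_
    · intro u _ v _ huv
      exact (pairwise_coprime_X_sub_C Function.injective_id huv).pow
    · obtain ⟨h1, h2, h3⟩ := hU u hu
      refine X_sub_C_pow_dvd_of_eulerDeriv ?_ h2 A hAq _ (hf u h1 h3)
      rintro rfl
      simp [hn.ne'] at h1
  have hdeg := natDegree_le_of_dvd hdvd hne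
  rw [natDegree_prod _ _ fun u _ => pow_ne_zero _ (X_sub_C_ne_zero u)] at hdeg
  simp only [natDegree_pow, natDegree_X_sub_C, mul_one, Finset.sum_const, smul_eq_mul] at hdeg
  have := natDegree_auxPoly_lt hb hn hAn f
  nlinarith

/-- The Stepanov bound with optimized parameters. -/
theorem four_mul_card_le_of_pow_eq_one_of_one_sub_pow_mem {F : Type*} [Field F] {q : ℕ} [CharP F q]
    {n K β : ℕ} (hn : 0 < n) (hK : 0 < K) (hβn : β ≤ n) (hβq : β ^ 2 < q)
    (hβ : 2 ^ 22 * n ^ 2 * K ^ 2 ≤ β ^ 3) (Y U : Finset F) (hY : Y.card ≤ K)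
    (hU : ∀ u ∈ U, u ^ n = 1 ∧ u ≠ 1 ∧ (1 - u) ^ n ∈ Y) : 4 * U.card ≤ β := by
  have hKn : 2 ^ 22 * K ^ 2 ≤ n := by
    have h1 : β ^ 3 ≤ n ^ 3 := Nat.pow_le_pow_left hβn 3
    have h2 : n ^ 2 * (2 ^ 22 * K ^ 2) ≤ n ^ 2 * n := by nlinarith
    exact Nat.le_of_mul_le_mul_left h2 (by positivity)
  obtain ⟨A, hA, hlow, hup⟩ : ∃ A, 0 < A ∧ 8 * K * A ^ 3 < n ^ 2 ∧ n ^ 2 ≤ 8 * K * (A + 1) ^ 3 := by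
    have hex : ∃ A, n ^ 2 ≤ 8 * K * (A + 1) ^ 3 := by
      refine ⟨n, ?_⟩
      calc n ^ 2 ≤ 1 * (n + 1) ^ 2 := by nlinarith
        _ ≤ 8 * K * (n + 1) ^ 3 := by gcongr <;> omega
    have hpos : 0 < Nat.find hex := by
      rw [Nat.find_pos]
      nlinarith
    refine ⟨Nat.find hex, hpos, ?_, Nat.find_spec hex⟩
    have := Nat.find_min hex (Nat.sub_lt hpos one_pos)
    rwa [not_le, Nat.sub_one_add_one hpos.ne'] at this
  have hup' : n ^ 2 ≤ 64 * K * A ^ 3 := by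
    have : (A + 1) ^ 3 ≤ (2 * A) ^ 3 := Nat.pow_le_pow_left (by omega) 3
    calc n ^ 2 ≤ 8 * K * (A + 1) ^ 3 := hup
      _ ≤ 8 * K * (2 * A) ^ 3 := by gcongr
      _ = 64 * K * A ^ 3 := by ring
  have hAn : A ≤ n := by
    by_contra! h
    have h1 : n ^ 2 < A ^ 2 := Nat.pow_lt_pow_left h (by norm_num)
    have h2 : A ^ 2 ≤ 8 * K * A ^ 3 := by
      calc A ^ 2 = 1 * 1 * A ^ 2 := by ring
        _ ≤ (8 * K) * A * A ^ 2 := by gcongr <;> omega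
        _ = _ := by ring
    omega
  have hAb : A * (n / A) ≤ n := Nat.mul_div_le n A
  have hb : 0 < n / A := Nat.div_pos hAn hA
  have hAb' : n ≤ 2 * (A * (n / A)) := by
    have := Nat.lt_mul_div_succ n hA
    nlinarith
  generalize n / A = b at *
  have hb2 : 2 * K * A < b ^ 2 := by
    have h1 : n ^ 2 ≤ (2 * (A * b)) ^ 2 := Nat.pow_le_pow_left hAb' 2
    have h2 : 4 * A ^ 2 * (2 * K * A) < 4 * A ^ 2 * b ^ 2 := by nlinarith
    exact Nat.lt_of_mul_lt_mul_left h2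
  have hnA : n ^ 2 ≤ q * A := by
    rw [← Nat.pow_le_pow_iff_left (n := 3) (by norm_num)]
    refine le_of_mul_le_mul_left (?_ : 64 * K * _ ≤ 64 * K * _) (by positivity)
    have h1 : (β ^ 2) ^ 3 ≤ q ^ 3 := Nat.pow_le_pow_left hβq.le 3
    have h2 : (2 ^ 22 * n ^ 2 * K ^ 2) ^ 2 ≤ (β ^ 3) ^ 2 := Nat.pow_le_pow_left hβ 2
    have h3 : 64 * K * n ^ 4 ≤ (2 ^ 22 * n ^ 2 * K ^ 2) ^ 2 := by
      calc 64 * K * n ^ 4 = 64 * K ^ 1 * n ^ 4 := by ring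
        _ ≤ 2 ^ 44 * K ^ 4 * n ^ 4 := by gcongr <;> omega
        _ = _ := by ring
    have h4 : 64 * K * n ^ 4 ≤ q ^ 3 := by
      calc _ ≤ _ := h3
        _ ≤ _ := h2
        _ = (β ^ 2) ^ 3 := by ring
        _ ≤ _ := h1
    calc 64 * K * (n ^ 2) ^ 3 = (64 * K * n ^ 4) * n ^ 2 := by ring
      _ ≤ q ^ 3 * (64 * K * A ^ 3) := by gcongr
      _ = _ := by ring
  have hnb : n * b ≤ q := by
    refine le_of_mul_le_mul_right (?_ : _ * A ≤ _ * A) hA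
    calc n * b * A = n * (A * b) := by ring
      _ ≤ n * n := by gcongr
      _ = n ^ 2 := by ring
      _ ≤ q * A := hnA
  have hcard := mul_card_le_of_pow_eq_one_of_one_sub_pow_mem hA hn hAb hnb Y U
    (lt_of_le_of_lt (by gcongr) hb2) hU
  have hβA : 8 * n ^ 2 ≤ β * A ^ 2 := by
    rw [← Nat.pow_le_pow_iff_left (n := 3) (by norm_num)]
    have h1 : (n ^ 2) ^ 2 ≤ (64 * K * A ^ 3) ^ 2 := Nat.pow_le_pow_left hup' 2
    calc (8 * n ^ 2) ^ 3 = 512 * n ^ 2 * (n ^ 2) ^ 2 := by ring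
      _ ≤ 1024 * n ^ 2 * (64 * K * A ^ 3) ^ 2 := by gcongr; norm_num
      _ = (2 ^ 22 * n ^ 2 * K ^ 2) * A ^ 6 := by ring
      _ ≤ β ^ 3 * A ^ 6 := by gcongr
      _ = _ := by ring
  refine le_of_mul_le_mul_right (?_ : _ * A ^ 2 ≤ _ * A ^ 2) (by positivity)
  calc 4 * U.card * A ^ 2 = 4 * A * (A * U.card) := by ring
    _ ≤ 4 * A * (2 * n * b) := by gcongr
    _ = 8 * n * (A * b) := by ring
    _ ≤ 8 * n * n := by gcongr
    _ = 8 * n ^ 2 := by ring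
    _ ≤ β * A ^ 2 := hβA

/-- A set of `n`-th roots of unity that is small compared with the field, but not too sparse among
the `n`-th roots of unity, has a large difference set. -/
theorem mul_card_le_card_sub {F : Type*} [Field F] [DecidableEq F] {q : ℕ} [CharP F q]
    {n K : ℕ} (hK : 0 < K) (hn : 0 < n) (B : Finset F) (hB : ∀ b ∈ B, b ^ n = 1)
    (hBn : B.card ≤ n) (hBq : B.card ^ 2 < q)
    (hBK : 2 ^ 22 * n ^ 2 * K ^ 2 ≤ B.card ^ 3) : K * B.card ≤ (B - B).card := by
  set β := B.card with hβ
  have hroot {u : F} : u ∈ Polynomial.nthRootsFinset n (1 : F) ↔ u ^ n = 1 :=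
    Polynomial.mem_nthRootsFinset hn 1
  have hB0 {a : F} (ha : a ∈ B) : a ≠ 0 := by
    rintro rfl
    simpa [hn.ne'] using hB 0 ha
  have hratio {a b : F} (ha : a ∈ B) (hb : b ∈ B) : (1 - b / a) ^ n = (a - b) ^ n := by
    rw [one_sub_div (hB0 ha), div_pow, hB a ha, div_one]
  let T (v : F) : Finset F := {u ∈ Polynomial.nthRootsFinset n (1 : F) | (1 - u) ^ n = v}
  have hT {u v : F} : u ∈ T v ↔ u ^ n = 1 ∧ (1 - u) ^ n = v := by
    rw [Finset.mem_filter, hroot]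
  have hTdisj (Y : Finset F) : (Y.biUnion T).card = ∑ v ∈ Y, (T v).card := by
    refine Finset.card_biUnion fun v _ w _ hvw => ?_
    rw [Function.onFun, Finset.disjoint_left]
    intro u hu hu'
    exact hvw ((hT.1 hu).2.symm.trans (hT.1 hu').2)
  have hbound (Y : Finset F) (h0 : 0 ∉ Y) (hY : Y.card ≤ K) : 4 * (Y.biUnion T).card ≤ β := by
    refine four_mul_card_le_of_pow_eq_one_of_one_sub_pow_mem hn hK hBn hBq hBK Y _ hY fun u hu => ?_
    obtain ⟨v, hv, hu⟩ := Finset.mem_biUnion.1 hu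
    rw [hT] at hu
    refine ⟨hu.1, ?_, hu.2 ▸ hv⟩
    rintro rfl
    rw [sub_self, zero_pow hn.ne'] at hu
    exact h0 (hu.2 ▸ hv)
  let P : Finset F := {v ∈ (B - B).image (· ^ n) | v ≠ 0 ∧ β < 4 * K * (T v).card}
  have hP0 : 0 ∉ P := by simp [P]
  have hPK : P.card ≤ K := by
    by_contra! h
    obtain ⟨Y, hYP, hY⟩ := Finset.exists_subset_card_eq h.le
    have h1 := hbound Y (fun h => hP0 (hYP h)) hY.le
    rw [hTdisj] at h1
    have h2 : K * β < 4 * K * ∑ v ∈ Y, (T v).card := by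
      rw [Finset.mul_sum, ← hY, ← smul_eq_mul, ← Finset.sum_const, hY]
      refine Finset.sum_lt_sum_of_nonempty (Finset.card_pos.1 (by omega)) fun v hv => ?_
      exact (Finset.mem_filter.1 (hYP hv)).2.2
    nlinarith
  have hPβ := hbound P hP0 hPK
  have hpop : {x ∈ B ×ˢ B | (x.1 - x.2) ^ n ∈ P}.card ≤ β * (P.biUnion T).card := by
    rw [hβ, ← Finset.card_product]
    refine Finset.card_le_card_of_injOn (fun x => (x.1, x.2 / x.1)) ?_ ?_
    · rintro ⟨a, b⟩ hx
      simp only [Finset.coe_filter, Finset.mem_product, Set.mem_ofPred_eq] at hx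
      obtain ⟨⟨ha, hb⟩, hab⟩ := hx
      refine Finset.mem_product.2 ⟨ha, Finset.mem_biUnion.2 ⟨_, hab, hT.2 ⟨?_, hratio ha hb⟩⟩⟩
      rw [div_pow, hB a ha, hB b hb, div_one]
    · rintro ⟨a, b⟩ hx ⟨a', b'⟩ hx' h
      simp only [Finset.coe_filter, Finset.mem_product, Set.mem_ofPred_eq] at hx
      simp only [Prod.mk.injEq] at h
      obtain ⟨rfl, h⟩ := h
      rw [div_left_inj' (hB0 hx.1.1)] at h
      rw [h]
  have hdiag : {x ∈ B ×ˢ B | x.1 - x.2 = 0}.card ≤ β := by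
    refine Finset.card_le_card_of_injOn Prod.fst ?_ ?_
    · rintro x hx
      simp only [Finset.coe_filter, Finset.mem_product, Set.mem_ofPred_eq] at hx
      exact hx.1.1
    · rintro ⟨a, b⟩ hx ⟨a', b'⟩ hx' h
      simp only [Finset.coe_filter, Finset.mem_product, Set.mem_ofPred_eq, sub_eq_zero] at hx hx' h
      rw [← hx.2, ← hx'.2, h]
  set R := {x ∈ B ×ˢ B | x.1 - x.2 ≠ 0 ∧ (x.1 - x.2) ^ n ∉ P} with hR
  have hrest : R.card ≤ β / (4 * K) * (B - B).card := by
    refine le_trans (Finset.card_le_mul_card_image (f := fun x => x.1 - x.2) R (β / (4 * K)) ?_)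
      (Nat.mul_le_mul_left _ (Finset.card_le_card ?_))
    · intro d hd
      obtain ⟨x, hx, rfl⟩ := Finset.mem_image.1 hd
      simp only [hR, Finset.mem_filter, Finset.mem_product] at hx
      obtain ⟨⟨h1, h2⟩, hd0, hdP⟩ := hx
      generalize hxd : x.1 - x.2 = d at *
      have hdT : 4 * K * (T (d ^ n)).card ≤ β := by
        by_contra! h
        refine hdP (Finset.mem_filter.2 ⟨Finset.mem_image_of_mem _ ?_, pow_ne_zero _ hd0, h⟩)
        rw [← hxd]
        exact Finset.sub_mem_sub h1 h2
      rw [Nat.le_div_iff_mul_le (by omega), mul_comm]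
      refine le_trans (Nat.mul_le_mul_left _ ?_) hdT
      refine Finset.card_le_card_of_injOn (fun x => x.2 / x.1) ?_ ?_
      · rintro ⟨a, b⟩ hx
        simp only [hR, Finset.coe_filter, Finset.mem_filter, Finset.mem_product,
          Set.mem_ofPred_eq] at hx
        obtain ⟨⟨⟨ha, hb⟩, -⟩, rfl⟩ := hx
        refine hT.2 ⟨?_, hratio ha hb⟩
        rw [div_pow, hB a ha, hB b hb, div_one]
      · rintro ⟨a, b⟩ hx ⟨a', b'⟩ hx' h
        simp only [hR, Finset.coe_filter, Finset.mem_filter, Finset.mem_product,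
          Set.mem_ofPred_eq] at hx hx'
        obtain ⟨⟨⟨ha, hb⟩, -⟩, hab⟩ := hx
        obtain ⟨⟨⟨ha', hb'⟩, -⟩, hab'⟩ := hx'
        have h1 : d / a = d / a' := by
          have h' : b / a = b' / a' := h
          nth_rewrite 1 [← hab]
          rw [← hab', sub_div, sub_div, div_self (hB0 ha), div_self (hB0 ha'), h']
        have h2 : a = a' := by
          rw [div_eq_div_iff (hB0 ha) (hB0 ha')] at h1
          exact (mul_left_cancel₀ hd0 h1).symm
        subst h2
        rw [← hab', sub_right_inj] at hab
        rw [hab]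
    · intro d hd
      obtain ⟨x, hx, rfl⟩ := Finset.mem_image.1 hd
      simp only [hR, Finset.mem_filter, Finset.mem_product] at hx
      exact Finset.sub_mem_sub hx.1.1 hx.1.2
  have htotal : β * β ≤ β + β * (P.biUnion T).card + β / (4 * K) * (B - B).card := by
    have hcover : B ×ˢ B ⊆ ({x ∈ B ×ˢ B | x.1 - x.2 = 0} ∪
        {x ∈ B ×ˢ B | (x.1 - x.2) ^ n ∈ P}) ∪ R := by
      intro x hx
      simp only [hR, Finset.mem_union, Finset.mem_filter, hx, true_and]
      tauto
    have h1 := Finset.card_le_card hcover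
    rw [Finset.card_product] at h1
    refine h1.trans ((Finset.card_union_le _ _).trans (add_le_add ?_ hrest))
    exact (Finset.card_union_le _ _).trans (add_le_add hdiag hpop)
  have hβ4 : 4 ≤ β := by
    by_contra! h
    have h1 : β ^ 3 ≤ 3 ^ 3 := Nat.pow_le_pow_left (by omega) 3
    have h2 : 1 ≤ n ^ 2 * K ^ 2 := Nat.succ_le_of_lt (by positivity)
    nlinarith
  have hdiv : β / (4 * K) * (4 * K) ≤ β := Nat.div_mul_le_self _ _
  refine le_of_mul_le_mul_left (?_ : β * _ ≤ β * _) (by omega)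
  have h1 : 2 * (β * β) ≤ 4 * (β / (4 * K) * (B - B).card) := by nlinarith
  have h2 : K * (2 * (β * β)) ≤ K * (4 * (β / (4 * K) * (B - B).card)) := Nat.mul_le_mul_left _ h1
  have h3 := Nat.mul_le_mul_right (B - B).card hdiv
  nlinarith

/-- **Lemma 5 (Konyagin).** There is an absolute constant `c > 0` such that: if `q` is
prime, `G` is a multiplicative subgroup of `F* = (ℤ/qℤ)*`, and `B` is a nonempty
subset of `G` with `|B| < |F|^(1/2)`, then `|B - B| ≥ c * |B|^(5/2) / |G|`. -/
theorem diff_card_ge_of_subset_subgroup :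
    ∃ c > (0 : ℝ), ∀ q : ℕ, q.Prime → ∀ G : Subgroup (ZMod q)ˣ,
      ∀ B : Finset (ZMod q), (∀ b ∈ B, ∃ u ∈ G, ((u : (ZMod q)ˣ) : ZMod q) = b) →
        B.Nonempty → (B.card : ℝ) < (q : ℝ) ^ ((1 : ℝ) / 2) →
          c * (B.card : ℝ) ^ ((5 : ℝ) / 2) / (Nat.card G : ℝ) ≤ ((B - B).card : ℝ) := by
  refine ⟨1 / 4096, by norm_num, fun q hq G B hBG hB hBq => ?_⟩
  have : Fact q.Prime := ⟨hq⟩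
  set n := Nat.card G with hn
  set β := B.card with hβ
  have hβ0 : 0 < β := hB.card_pos
  have hn0 : 0 < n := Nat.card_pos
  have hpow (b : ZMod q) (hb : b ∈ B) : b ^ n = 1 := by
    obtain ⟨u, hu, rfl⟩ := hBG b hb
    have : (⟨u, hu⟩ : G) ^ n = 1 := pow_card_eq_one'
    have h := congrArg (fun g : G => ((g : (ZMod q)ˣ) : ZMod q)) this
    simpa using h
  have hβn : β ≤ n := by
    choose! f hfG hf using hBG
    rw [hβ, hn, ← Nat.card_eq_finsetCard B]
    refine Nat.card_le_card_of_injective (fun b : B => (⟨f b, hfG b b.2⟩ : G)) fun a b hab => ?_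
    have h : f a = f b := congrArg Subtype.val hab
    exact Subtype.ext (by rw [← hf a a.2, ← hf b b.2, h])
  have hβq : β ^ 2 < q := by
    rw [← Real.sqrt_eq_rpow, Real.lt_sqrt (by positivity)] at hBq
    exact_mod_cast hBq
  have htriv : β ≤ (B - B).card := Finset.card_le_card_sub_right hB
  have hn0' : (0 : ℝ) < n := by exact_mod_cast hn0
  set s : ℝ := (β : ℝ) ^ ((3 : ℝ) / 2) with hs
  have hs0 : 0 ≤ s := by positivity
  have hs2 : s ^ 2 = (β : ℝ) ^ 3 := by
    rw [hs, ← Real.rpow_natCast, ← Real.rpow_mul (by positivity), ← Real.rpow_natCast]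
    norm_num
  have hs5 : (β : ℝ) ^ ((5 : ℝ) / 2) = β * s := by
    rw [hs, show (5 : ℝ) / 2 = 1 + 3 / 2 by norm_num, Real.rpow_add (by positivity), Real.rpow_one]
  rw [hs5, div_le_iff₀ hn0']
  set K := ⌊s / (2048 * n)⌋₊ with hK
  have hKle : (K : ℝ) * (2048 * n) ≤ s := by
    rw [← le_div_iff₀ (by positivity)]
    exact Nat.floor_le (by positivity)
  have hKlt : s < (K + 1) * (2048 * n) := by
    rw [← div_lt_iff₀ (by positivity)]
    exact Nat.lt_floor_add_one _
  have hmain : (max K 1) * β ≤ (B - B).card := by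
    rcases Nat.eq_zero_or_pos K with h0 | h0
    · simpa [h0] using htriv
    · rw [max_eq_left h0]
      refine mul_card_le_card_sub (q := q) h0 hn0 B hpow hβn hβq ?_
      have : ((K : ℝ) * (2048 * n)) ^ 2 ≤ s ^ 2 := by gcongr
      rw [hs2] at this
      have h' : (2 ^ 22 * n ^ 2 * K ^ 2 : ℝ) ≤ (β : ℝ) ^ 3 := by
        refine le_trans (le_of_eq ?_) this
        ring
      exact_mod_cast h'
  have hmax : (K : ℝ) + 1 ≤ 2 * (max K 1 : ℕ) := by
    exact_mod_cast (by omega : K + 1 ≤ 2 * max K 1)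
  have hmain' : ((max K 1 : ℕ) : ℝ) * β ≤ (B - B).card := by exact_mod_cast hmain
  calc 1 / 4096 * (β * s) ≤ 1 / 4096 * (β * ((2 * (max K 1 : ℕ)) * (2048 * n))) := by
        gcongr
        exact hKlt.le.trans (by gcongr)
    _ = ((max K 1 : ℕ) : ℝ) * β * n := by ring
    _ ≤ (B - B).card * n := by gcongr
end

section
/- There exists an absolute constant C > 0 such that the following holds: let q be a prime, F = ℤ/qℤ, let G be a multiplicative subgroup of F* = F \ {0}, and let B be a subset of G with |B| < |F|^{1/2}. Then the number of quadruples (b₁,b₂,b₃,b₄) ∈ B⁴ satisfying b₁−b₂ = b₃−b₄ ≠ 0 is at most C·|B|^{3/2}·|G|. -/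
open Polynomial Finset

/-- Over a field of characteristic `p`, a nonzero polynomial of degree below `p` vanishes at a
nonzero point to order smaller than its number of terms. -/
theorem lt_card_support_of_pow_dvd {K : Type*} [Field K] (p : ℕ) [CharP K p] {x : K}
    (hx : x ≠ 0) (k : ℕ) (f : K[X]) (hf : f ≠ 0) (hdeg : f.natDegree < p)
    (hdvd : (X - C x) ^ k ∣ f) : k < #f.support := by
  induction k generalizing f with
  | zero => exact Finset.card_pos.2 (nonempty_support_iff.2 hf)
  | succ k ih =>
    obtain ⟨n, hn⟩ := nonempty_support_iff.2 hf
    set h : K[X] := X * derivative f - C (n : K) * f with h_def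
    have hcoeff : ∀ i, h.coeff i = ((i : K) - n) * f.coeff i := by
      intro i
      rcases i with _ | i
      · simp [h_def]
      · simp only [h_def, coeff_sub, coeff_X_mul, coeff_derivative, coeff_C_mul]
        push_cast
        ring
    have hsub : h.support ⊆ f.support.erase n := by
      intro i hi
      rw [mem_support_iff, hcoeff] at hi
      refine Finset.mem_erase.2 ⟨?_, mem_support_iff.2 (right_ne_zero_of_mul hi)⟩
      rintro rfl
      simp at hi
    have hlt : ∀ i ∈ f.support, i < p := fun i hi => (le_natDegree_of_mem_supp i hi).trans_lt hdeg
    have hdvd_h : (X - C x) ^ k ∣ h := by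
      refine dvd_sub (Dvd.dvd.mul_left ?_ _) (Dvd.dvd.mul_left ?_ _)
      · simpa using pow_sub_one_dvd_derivative_of_pow_dvd hdvd
      · exact (pow_dvd_pow _ k.le_succ).trans hdvd
    have h_ne : h ≠ 0 := by
      intro h0
      have hmono : f = monomial n (f.coeff n) := by
        ext i
        rw [coeff_monomial]
        split_ifs with hin
        · rw [hin]
        · by_contra hi
          have := hcoeff i
          rw [h0, coeff_zero, eq_comm, mul_eq_zero, sub_eq_zero] at this
          rcases this with h1 | h1
          · have h2 := (CharP.natCast_eq_natCast K p).1 h1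
            exact hin (h2.eq_of_lt_of_lt (hlt i (mem_support_iff.2 hi)) (hlt n hn)).symm
          · exact hi h1
      have hroot : f.eval x = 0 := by
        rw [← IsRoot.def, ← dvd_iff_isRoot]
        exact (dvd_pow_self _ k.succ_ne_zero).trans hdvd
      rw [hmono, eval_monomial] at hroot
      exact mul_ne_zero (mem_support_iff.1 hn) (pow_ne_zero n hx) hroot
    have hdeg_h : h.natDegree < p :=
      hlt _ (Finset.mem_of_mem_erase (hsub (natDegree_mem_support_of_nonzero h_ne)))
    have h1 := ih h h_ne hdeg_h hdvd_h
    have h2 := Finset.card_le_card hsub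
    rw [Finset.card_erase_of_mem hn] at h2
    omega

/-- Expansions in powers of `u` whose digits are not nonzero multiples of `u` are unique. -/
theorem eq_zero_of_sum_mul_pow_eq_zero {R : Type*} [CommRing R] [IsDomain R] {u : R}
    (hu : u ≠ 0) (n : ℕ) (f : Fin n → R) (hf : ∀ c, u ∣ f c → f c = 0)
    (hsum : ∑ c, f c * u ^ (c : ℕ) = 0) (c : Fin n) : f c = 0 := by
  induction n with
  | zero => exact c.elim0
  | succ n ih =>
    rw [Fin.sum_univ_succ] at hsum
    have hfac : ∑ i : Fin n, f i.succ * u ^ (i.succ : ℕ)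
        = u * ∑ i : Fin n, f i.succ * u ^ (i : ℕ) := by
      rw [Finset.mul_sum]
      refine Finset.sum_congr rfl fun i _ => ?_
      rw [Fin.val_succ, pow_succ]
      ring
    rw [hfac] at hsum
    have h0 : f 0 = 0 := by
      refine hf 0 ⟨-∑ i : Fin n, f i.succ * u ^ (i : ℕ), ?_⟩
      simp only [Fin.val_zero, pow_zero, mul_one] at hsum
      linear_combination hsum
    rw [h0, zero_mul, zero_add] at hsum
    have hrest := (mul_eq_zero.1 hsum).resolve_left hu
    refine Fin.cases h0 (fun i => ?_) c
    exact ih (fun i => f i.succ) (fun i => hf i.succ) hrest i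

/-- The polynomials `X ^ (a + t * b) * (X - 1) ^ (t * c)` with `a < A` and `b, c < M` are linearly
independent when `A * M ≤ t` and `t * M` is at most the characteristic. -/
theorem eq_zero_of_sum_monomial_mul_pow_eq_zero {K : Type*} [Field K] (p : ℕ) [CharP K p]
    {t A M : ℕ} (hAM : A * M ≤ t) (htM : t * M ≤ p) (w : Fin A × Fin M × Fin M → K)
    (hsum : ∑ i, C (w i) * (X ^ (i.1 : ℕ) * (X ^ (t * i.2.1 : ℕ) * (X - 1) ^ (t * i.2.2 : ℕ)))
      = (0 : K[X])) : w = 0 := by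
  set f : Fin M → K[X] := fun c =>
    ∑ i : Fin A × Fin M, monomial (i.1 + t * i.2 : ℕ) (w (i.1, i.2, c)) with f_def
  have hinj : ∀ i j : Fin A × Fin M, (i.1 + t * i.2 : ℕ) = j.1 + t * j.2 → i = j := by
    rintro ⟨a, b⟩ ⟨a', b'⟩ h
    have hM : 1 ≤ M := b.pos
    have hAt : A ≤ t := (Nat.le_mul_of_pos_right A hM).trans hAM
    have ha := a.2.trans_le hAt
    have ha' := a'.2.trans_le hAt
    have h1 : (a : ℕ) = a' := by
      have := congrArg (· % t) h
      simpa [Nat.mod_eq_of_lt ha, Nat.mod_eq_of_lt ha'] using this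
    have h2 : (b : ℕ) = b' := by
      simp only [h1] at h
      exact Nat.eq_of_mul_eq_mul_left (by omega) (Nat.add_left_cancel h)
    exact Prod.ext (Fin.ext h1) (Fin.ext h2)
  have hcoeff : ∀ c (i : Fin A × Fin M), (f c).coeff (i.1 + t * i.2) = w (i.1, i.2, c) := by
    intro c i
    rw [f_def, finsetSum_coeff, Finset.sum_eq_single i]
    · simp
    · intro j _ hj
      exact coeff_monomial_of_ne _ fun h => hj (hinj _ _ h.symm)
    · simp
  have hsupp : ∀ c, (f c).support ⊆ Finset.univ.image
      fun i : Fin A × Fin M => (i.1 + t * i.2 : ℕ) := by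
    intro c n hn
    by_contra hcon
    refine mem_support_iff.1 hn ?_
    rw [f_def, finsetSum_coeff]
    refine Finset.sum_eq_zero fun i _ => coeff_monomial_of_ne _ fun h => hcon ?_
    exact Finset.mem_image.2 ⟨i, Finset.mem_univ _, h.symm⟩
  have hf : ∀ c, (X - 1) ^ t ∣ f c → f c = 0 := by
    intro c hdvd
    by_contra hne
    have hdeg : (f c).natDegree < p := by
      obtain ⟨⟨a, b⟩, -, h⟩ := Finset.mem_image.1 (hsupp c (natDegree_mem_support_of_nonzero hne))
      rw [← h]
      have hAt : A ≤ t := (Nat.le_mul_of_pos_right A b.pos).trans hAM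
      calc (a : ℕ) + t * b < t + t * b := by have := a.2; omega
        _ = t * (b + 1) := by ring
        _ ≤ t * M := Nat.mul_le_mul_left _ b.2
        _ ≤ p := htM
    have h1 := lt_card_support_of_pow_dvd p (one_ne_zero (α := K)) t (f c) hne hdeg
      (by simpa using hdvd)
    have h2 := (Finset.card_le_card (hsupp c)).trans Finset.card_image_le
    simp only [Finset.card_univ, Fintype.card_prod, Fintype.card_fin] at h2
    omega
  have hu : ((X - 1) ^ t : K[X]) ≠ 0 := pow_ne_zero _ (by simpa using X_sub_C_ne_zero (1 : K))
  have hzero : ∀ c, f c = 0 := by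
    refine eq_zero_of_sum_mul_pow_eq_zero hu M f hf ?_
    rw [← hsum]
    simp only [f_def, Finset.sum_mul, Fintype.sum_prod_type]
    rw [Finset.sum_comm]
    refine Finset.sum_congr rfl fun a _ => ?_
    rw [Finset.sum_comm]
    refine Finset.sum_congr rfl fun b _ => Finset.sum_congr rfl fun c _ => ?_
    rw [← C_mul_X_pow_eq_monomial, pow_add, pow_mul (X - 1)]
    ring
  funext ⟨a, b, c⟩
  rw [← hcoeff c (a, b), hzero]
  simp

/-- The derivation `X (X - 1) d/dX`, twisted by `X ^ m * (X - 1) ^ n`. -/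
noncomputable def twistedDerivation (K : Type*) [Field K] (m n : ℕ) : K[X] →ₗ[K] K[X] :=
  LinearMap.mulLeft K (X * (X - 1)) ∘ₗ derivative
    + LinearMap.mulLeft K ((m : K[X]) * (X - 1) + (n : K[X]) * X)

theorem twistedDerivation_apply {K : Type*} [Field K] (m n : ℕ) (f : K[X]) :
    twistedDerivation K m n f
      = X * (X - 1) * derivative f + ((m : K[X]) * (X - 1) + (n : K[X]) * X) * f := by
  simp [twistedDerivation, mul_assoc]

theorem twistedDerivation_zero_mul {K : Type*} [Field K] (m n : ℕ) (f : K[X]) :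
    twistedDerivation K 0 0 (f * (X ^ m * (X - 1) ^ n))
      = twistedDerivation K m n f * (X ^ m * (X - 1) ^ n) := by
  have hX : ∀ k : ℕ, (X : K[X]) * derivative (X ^ k) = (k : K[X]) * X ^ k := by
    rintro (_ | k)
    · simp
    · rw [derivative_X_pow]
      simp only [Nat.add_sub_cancel, map_natCast]
      ring
  have hX1 : ∀ k : ℕ, (X - 1 : K[X]) * derivative ((X - 1) ^ k) = (k : K[X]) * (X - 1) ^ k := by
    rintro (_ | k)
    · simp
    · rw [derivative_pow]
      simp only [Nat.add_sub_cancel, map_natCast, derivative_sub, derivative_X, derivative_one]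
      ring
  simp only [twistedDerivation_apply, derivative_mul]
  push_cast
  linear_combination f * (X - 1) * (X - 1) ^ n * hX m + f * X * X ^ m * hX1 n

theorem twistedDerivation_zero_pow_mul {K : Type*} [Field K] (m n k : ℕ) (f : K[X]) :
    (twistedDerivation K 0 0 ^ k) (f * (X ^ m * (X - 1) ^ n))
      = (twistedDerivation K m n ^ k) f * (X ^ m * (X - 1) ^ n) := by
  induction k with
  | zero => simp
  | succ k ih => rw [pow_succ', pow_succ', Module.End.mul_apply, ih, twistedDerivation_zero_mul,
      Module.End.mul_apply]

theorem natDegree_twistedDerivation_pow_le {K : Type*} [Field K] (m n k : ℕ) (f : K[X]) :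
    ((twistedDerivation K m n ^ k) f).natDegree ≤ f.natDegree + k := by
  induction k with
  | zero => simp
  | succ k ih =>
    rw [pow_succ', Module.End.mul_apply, twistedDerivation_apply]
    set g := (twistedDerivation K m n ^ k) f
    have h1 : (X * (X - 1) * derivative g).natDegree ≤ g.natDegree + 1 := by
      by_cases hg : derivative g = 0
      · simp [hg]
      · have hpos : g.natDegree ≠ 0 := fun h => hg (derivative_of_natDegree_zero h)
        have := natDegree_derivative_lt hpos
        have h2 : (X * (X - 1) : K[X]).natDegree ≤ 2 := by compute_degree
        have h3 := natDegree_mul_le (p := (X * (X - 1) : K[X])) (q := derivative g)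
        omega
    have h2 : (((m : K[X]) * (X - 1) + (n : K[X]) * X) * g).natDegree ≤ g.natDegree + 1 := by
      have h2 : ((m : K[X]) * (X - 1) + (n : K[X]) * X).natDegree ≤ 1 := by compute_degree
      have h3 := natDegree_mul_le (p := (m : K[X]) * (X - 1) + (n : K[X]) * X) (q := g)
      omega
    have := natDegree_add_le_of_degree_le h1 h2
    omega

theorem pow_dvd_of_twistedDerivation_pow_eval_eq_zero {K : Type*} [Field K] (p : ℕ) [CharP K p]
    {x : K} (hx0 : x ≠ 0) (hx1 : x ≠ 1) (k : ℕ) (hk : k ≤ p) (f : K[X])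
    (hf : ∀ n < k, ((twistedDerivation K 0 0 ^ n) f).eval x = 0) : (X - C x) ^ k ∣ f := by
  induction k generalizing f with
  | zero => simp
  | succ k ih =>
    have hk0 := ih (by omega) f fun n hn => hf n (by omega)
    rcases k with _ | k
    · simpa [dvd_iff_isRoot] using hf 0 one_pos
    · have h1 : (X - C x) ^ (k + 1) ∣ X * (X - 1) * derivative f := by
        have := ih (by omega) (twistedDerivation K 0 0 f) fun n hn => by
          simpa [pow_succ] using hf (n + 1) (by omega)
        simpa [twistedDerivation_apply] using this
      have hcop : IsCoprime ((X - C x) ^ (k + 1)) (X * (X - 1)) := by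
        refine IsCoprime.pow_left (IsCoprime.mul_right ?_ ?_)
        · simpa using isCoprime_X_sub_C_of_isUnit_sub (a := x) (b := 0) (by simpa using hx0)
        · simpa using isCoprime_X_sub_C_of_isUnit_sub (a := x) (b := 1)
            (by simpa [sub_eq_zero] using hx1)
      have h2 := hcop.dvd_of_dvd_mul_left h1
      obtain ⟨g, rfl⟩ := hk0
      rw [pow_succ (X - C x) (k + 1)]
      refine mul_dvd_mul_left _ ?_
      rw [derivative_mul, derivative_X_sub_C_pow] at h2
      have h3 := (dvd_add_left (dvd_mul_right _ _)).1 h2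
      rw [Nat.add_sub_cancel, pow_succ, mul_comm (C _), mul_assoc] at h3
      have h4 := (mul_dvd_mul_iff_left (pow_ne_zero k (X_sub_C_ne_zero x))).1 h3
      rw [dvd_iff_isRoot, IsRoot.def, eval_mul, eval_C, mul_eq_zero] at h4
      rw [dvd_iff_isRoot]
      refine h4.resolve_left fun h => ?_
      have := Nat.le_of_dvd (by omega) ((CharP.cast_eq_zero_iff K p _).1 h)
      omega

/-- **Stepanov's method**: a bound for the number of `t`-th roots of unity `x` whose
`(x - 1) ^ t` lies in a small set `T`, from an auxiliary polynomial vanishing to order `A`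
at each of them. -/
theorem mul_card_le_of_pow_eq_one {K : Type*} [Field K] [DecidableEq K] (p : ℕ) [CharP K p]
    {t A M : ℕ} (hA : 0 < A) (hAM : A * M ≤ t) (htM : t * M ≤ p) (S T : Finset K)
    (hT : 0 ∉ T) (hJ : 2 * A * #T < M ^ 2) (hS : ∀ x ∈ S, x ^ t = 1 ∧ (x - 1) ^ t ∈ T) :
    A * #S ≤ 2 * t * M := by
  have hM : 0 < M := Nat.pos_of_ne_zero (by rintro rfl; simp at hJ)
  have hAt : A ≤ t := (Nat.le_mul_of_pos_right A hM).trans hAM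
  have hAp : A ≤ p := hAt.trans ((Nat.le_mul_of_pos_right t hM).trans htM)
  have ht : t ≠ 0 := by omega
  -- `Q n c` is the `n`-th derivative with the power of `X - 1` specialised to `c`
  let Q : ℕ → K → (Fin A × Fin M × Fin M → K) →ₗ[K] K[X] := fun n c =>
    ∑ i, (c ^ (i.2.2 : ℕ)) • (LinearMap.toSpanSingleton K K[X]
      ((twistedDerivation K (t * i.2.1) (t * i.2.2) ^ n) (X ^ (i.1 : ℕ)))) ∘ₗ LinearMap.proj i
  have hQ : ∀ n c w, Q n c w = ∑ i, c ^ (i.2.2 : ℕ) • w i •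
      (twistedDerivation K (t * i.2.1) (t * i.2.2) ^ n) (X ^ (i.1 : ℕ)) := by
    intro n c w
    simp [Q, LinearMap.sum_apply]
  let Φ : (Fin A × Fin M × Fin M → K) →ₗ[K] (Fin A × T × Fin (2 * A) → K) :=
    LinearMap.pi fun j => lcoeff K (j.2.2 : ℕ) ∘ₗ Q j.1 j.2.1
  have hker : LinearMap.ker Φ ≠ ⊥ := by
    apply LinearMap.ker_ne_bot_of_finrank_lt
    simp only [Module.finrank_fintype_fun_eq_card, Fintype.card_prod, Fintype.card_fin,
      Fintype.card_coe]
    calc A * (#T * (2 * A)) = A * (2 * A * #T) := by ring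
      _ < A * M ^ 2 := Nat.mul_lt_mul_of_pos_left hJ hA
      _ = A * (M * M) := by ring
  obtain ⟨w, hw, hw0⟩ := (Submodule.ne_bot_iff _).1 hker
  have hQ0 : ∀ n < A, ∀ c ∈ T, Q n c w = 0 := by
    intro n hn c hc
    ext d
    rw [coeff_zero]
    by_cases hd : d < 2 * A
    · exact congrFun (LinearMap.mem_ker.1 hw) (⟨n, hn⟩, ⟨c, hc⟩, ⟨d, hd⟩)
    · apply coeff_eq_zero_of_natDegree_lt
      refine lt_of_le_of_lt ?_ (show 2 * A - 1 < d by omega)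
      rw [hQ]
      refine natDegree_sum_le_of_forall_le _ _ fun i _ => ?_
      refine (natDegree_smul_le _ _).trans ((natDegree_smul_le _ _).trans ?_)
      refine (natDegree_twistedDerivation_pow_le _ _ _ _).trans ?_
      rw [natDegree_X_pow]
      have := i.1.2
      omega
  set f : K[X] := ∑ i, C (w i) *
    (X ^ (i.1 : ℕ) * (X ^ (t * i.2.1 : ℕ) * (X - 1) ^ (t * i.2.2 : ℕ))) with f_def
  have hf : f ≠ 0 := fun h => hw0 (eq_zero_of_sum_monomial_mul_pow_eq_zero p hAM htM w h)
  have hdvd : ∀ x ∈ S, (X - C x) ^ A ∣ f := by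
    intro x hx
    obtain ⟨hxt, hxT⟩ := hS x hx
    refine pow_dvd_of_twistedDerivation_pow_eval_eq_zero p ?_ ?_ A hAp f fun n hn => ?_
    · rintro rfl
      simp [ht] at hxt
    · rintro rfl
      exact hT (by simpa [ht] using hxT)
    · have h0 := congrArg (eval x) (hQ0 n hn _ hxT)
      rw [hQ, eval_zero, eval_finsetSum] at h0
      rw [f_def, map_sum, eval_finsetSum, ← h0]
      refine Finset.sum_congr rfl fun i _ => ?_
      rw [← smul_eq_C_mul, map_smul, twistedDerivation_zero_pow_mul]
      simp only [eval_smul, eval_mul, eval_pow, eval_X, eval_sub, eval_one, smul_eq_mul, pow_mul,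
        hxt, one_pow]
      ring
  have hprod : ∏ x ∈ S, (X - C x) ^ A ∣ f := by
    refine Finset.prod_dvd_of_coprime (fun x _ y _ hxy => ?_) hdvd
    exact IsCoprime.pow (isCoprime_X_sub_C_of_isUnit_sub (sub_ne_zero.2 hxy).isUnit)
  have hle := natDegree_le_of_dvd hprod hf
  have hdeg : (∏ x ∈ S, (X - C x) ^ A).natDegree = A * #S := by
    rw [natDegree_prod_of_monic _ _ fun x _ => (monic_X_sub_C x).pow A]
    simp [mul_comm]
  rw [hdeg] at hle
  refine hle.trans ?_
  rw [f_def]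
  refine natDegree_sum_le_of_forall_le _ _ fun i _ => ?_
  refine (natDegree_C_mul_le _ _).trans ?_
  have hX1 : ((X - 1 : K[X]) ^ (t * i.2.2 : ℕ)).natDegree = t * i.2.2 := by
    rw [natDegree_pow, show (X - 1 : K[X]) = X - C 1 by simp, natDegree_X_sub_C, mul_one]
  have h1 := natDegree_mul_le (p := (X : K[X]) ^ (i.1 : ℕ))
    (q := X ^ (t * i.2.1 : ℕ) * (X - 1) ^ (t * i.2.2 : ℕ))
  have h2 := natDegree_mul_le (p := (X : K[X]) ^ (t * i.2.1 : ℕ)) (q := (X - 1) ^ (t * i.2.2 : ℕ))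
  rw [natDegree_X_pow] at h1 h2
  rw [hX1] at h2
  have h3 : t * (i.2.1 + 1 : ℕ) ≤ t * M := Nat.mul_le_mul_left _ i.2.1.2
  have h4 : t * (i.2.2 + 1 : ℕ) ≤ t * M := Nat.mul_le_mul_left _ i.2.2.2
  have := i.1.2
  linarith

theorem exists_pow_three_le_lt (n : ℕ) : ∃ m : ℕ, m ^ 3 ≤ n ∧ n < (m + 1) ^ 3 := by
  induction n with
  | zero => exact ⟨0, by simp⟩
  | succ n ih =>
    obtain ⟨m, h1, h2⟩ := ih
    by_cases h : n + 1 < (m + 1) ^ 3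
    · exact ⟨m, by omega, h⟩
    · exact ⟨m + 1, by omega, by nlinarith [sq_nonneg m]⟩

/-- The points of a union of level sets of `(x - 1) ^ t` among `t`-th roots of unity number
`O((t J) ^ (2 / 3))`, where `J` is the number of levels. -/
theorem card_pow_three_le_of_pow_eq_one {K : Type*} [Field K] [DecidableEq K] (p : ℕ) [CharP K p]
    {t b : ℕ} (ht : 64 ≤ t) (hbt : b ≤ t) (hbp : b ^ 2 ≤ p) (S T : Finset K) (hT : 0 ∉ T)
    (hTne : T.Nonempty) (hTb : (t * #T) ^ 2 ≤ b ^ 3)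
    (hS : ∀ x ∈ S, x ^ t = 1 ∧ (x - 1) ^ t ∈ T) : #S ^ 3 ≤ 2 ^ 12 * (t * #T) ^ 2 := by
  have hJ : 0 < #T := hTne.card_pos
  set J := #T with J_def
  obtain ⟨m, hm1, hm2⟩ := exists_pow_three_le_lt (t * J)
  have hm : 0 < m := by
    refine Nat.pos_of_ne_zero ?_
    rintro rfl
    have : 0 < t * J := by positivity
    omega
  have hm8 : t * J < 8 * m ^ 3 := hm2.trans_le <| by
    calc (m + 1) ^ 3 ≤ (2 * m) ^ 3 := Nat.pow_le_pow_left (by omega) 3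
      _ = 8 * m ^ 3 := by ring
  have hJt : J ^ 2 ≤ t := by
    have h1 : t ^ 2 * J ^ 2 ≤ t ^ 2 * t := by
      calc t ^ 2 * J ^ 2 = (t * J) ^ 2 := by ring
        _ ≤ b ^ 3 := hTb
        _ ≤ t ^ 3 := Nat.pow_le_pow_left hbt 3
        _ = t ^ 2 * t := by ring
    exact Nat.le_of_mul_le_mul_left h1 (by positivity)
  have hmJ : 2 * J < m ^ 2 := by
    by_contra! hcon
    have h1 : J ^ 2 * t ^ 2 < J ^ 2 * (512 * J) := by
      calc J ^ 2 * t ^ 2 = (t * J) ^ 2 := by ring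
        _ < (8 * m ^ 3) ^ 2 := Nat.pow_lt_pow_left hm8 two_ne_zero
        _ = 64 * (m ^ 2) ^ 3 := by ring
        _ ≤ 64 * (2 * J) ^ 3 := by gcongr
        _ = J ^ 2 * (512 * J) := by ring
    have h2 : t ^ 2 < 512 * J := Nat.lt_of_mul_lt_mul_left h1
    have h3 : t * t ^ 3 < t * 64 ^ 3 := by
      calc t * t ^ 3 = (t ^ 2) ^ 2 := by ring
        _ < (512 * J) ^ 2 := Nat.pow_lt_pow_left h2 two_ne_zero
        _ = 64 ^ 3 * J ^ 2 := by ring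
        _ ≤ 64 ^ 3 * t := by gcongr
        _ = t * 64 ^ 3 := by ring
    exact absurd (Nat.pow_le_pow_left ht 3) (not_le.2 (Nat.lt_of_mul_lt_mul_left h3))
  have htm : t * m ≤ p := by
    refine le_trans ?_ hbp
    have htb : t ^ 2 ≤ b ^ 3 := le_trans (Nat.pow_le_pow_left (Nat.le_mul_of_pos_right t hJ) 2) hTb
    refine (Nat.pow_le_pow_iff_left (n := 6) (by norm_num)).1 ?_
    calc (t * m) ^ 6 = (t ^ 2) ^ 3 * (m ^ 3) ^ 2 := by ring
      _ ≤ (b ^ 3) ^ 3 * (t * J) ^ 2 := by gcongr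
      _ ≤ (b ^ 3) ^ 3 * b ^ 3 := by gcongr
      _ = (b ^ 2) ^ 6 := by ring
  set A := (m ^ 2 - 1) / (2 * J) with A_def
  have hA : 0 < A := Nat.div_pos (by omega) (by omega)
  have hA1 : 2 * J * A ≤ m ^ 2 - 1 := Nat.mul_div_le _ _
  have hA2 : m ^ 2 - 1 < 2 * J * (A + 1) := Nat.lt_mul_div_succ _ (by omega)
  have hA3 : m ^ 2 ≤ 4 * J * A := by
    have : 2 * J ≤ 2 * J * A := Nat.le_mul_of_pos_right _ hA
    linarith [show m ^ 2 ≤ 2 * J * (A + 1) by omega]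
  have hAm : A * m ≤ t := by
    refine Nat.le_of_mul_le_mul_left (c := J) ?_ hJ
    calc J * (A * m) ≤ 2 * J * A * m := by nlinarith [Nat.zero_le (J * A * m)]
      _ ≤ m ^ 2 * m := by gcongr; omega
      _ = m ^ 3 := by ring
      _ ≤ t * J := hm1
      _ = J * t := by ring
  have hmain := mul_card_le_of_pow_eq_one p hA hAm htm S T hT
    (by rw [← J_def]; linarith [show 2 * J * A < m ^ 2 by omega]) hS
  have hlin : m * #S ≤ 8 * (t * J) := by
    refine Nat.le_of_mul_le_mul_left (c := m) ?_ hm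
    calc m * (m * #S) = m ^ 2 * #S := by ring
      _ ≤ 4 * J * A * #S := by gcongr
      _ = 4 * J * (A * #S) := by ring
      _ ≤ 4 * J * (2 * t * m) := by gcongr
      _ = m * (8 * (t * J)) := by ring
  refine Nat.le_of_mul_le_mul_left (c := t * J) ?_ (by positivity)
  calc t * J * #S ^ 3 ≤ 8 * m ^ 3 * #S ^ 3 := by gcongr
    _ = 8 * (m * #S) ^ 3 := by ring
    _ ≤ 8 * (8 * (t * J)) ^ 3 := by gcongr
    _ = t * J * (2 ^ 12 * (t * J) ^ 2) := by ring

/-- The `t`-th roots of unity `y` with `(y - 1) ^ t = c`. -/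
def rootsOfLevel {K : Type*} [Field K] [DecidableEq K] [Fintype K] (t : ℕ) (c : K) : Finset K :=
  Finset.univ.filter fun y => y ^ t = 1 ∧ (y - 1) ^ t = c

/-- The `t`-th roots of unity `x ≠ 1` lying in a level set with at least `s` elements. -/
def richRoots (K : Type*) [Field K] [DecidableEq K] [Fintype K] (t s : ℕ) : Finset K :=
  Finset.univ.filter fun x => x ^ t = 1 ∧ x ≠ 1 ∧ s ≤ #(rootsOfLevel t ((x - 1) ^ t))

theorem card_richRoots_mul_sq_le {K : Type*} [Field K] [DecidableEq K] [Fintype K] (p : ℕ)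
    [CharP K p] {t b s : ℕ} (ht : 64 ≤ t) (hbt : b ≤ t) (hbp : b ^ 2 ≤ p) (htb : t ^ 2 ≤ b ^ 3)
    (hs : 2 ^ 10 * t ^ 2 ≤ s ^ 2 * b) : #(richRoots K t s) * s ^ 2 ≤ 2 ^ 12 * t ^ 2 := by
  set R := richRoots K t s with R_def
  set T := R.image fun x => (x - 1) ^ t with T_def
  have ht0 : t ≠ 0 := by omega
  have hT0 : (0 : K) ∉ T := by
    intro h
    obtain ⟨x, hx, h0⟩ := Finset.mem_image.1 h
    have hx1 := (Finset.mem_filter.1 hx).2.2.1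
    exact hx1 (sub_eq_zero.1 (pow_eq_zero_iff ht0 |>.1 h0))
  have hkey : ∀ U ⊆ T, U.Nonempty → (t * #U) ^ 2 ≤ b ^ 3 →
      s * #U ≤ #(R.filter fun x => (x - 1) ^ t ∈ U) ∧
      #(R.filter fun x => (x - 1) ^ t ∈ U) ^ 3 ≤ 2 ^ 12 * (t * #U) ^ 2 := by
    intro U hU hne hUb
    refine ⟨?_, card_pow_three_le_of_pow_eq_one p ht hbt hbp _ U (fun h => hT0 (hU h)) hne hUb ?_⟩
    · have hmaps : ∀ x ∈ R.filter (fun x => (x - 1) ^ t ∈ U), (x - 1) ^ t ∈ U :=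
        fun x hx => (Finset.mem_filter.1 hx).2
      rw [Finset.card_eq_sum_card_fiberwise hmaps, mul_comm, ← smul_eq_mul]
      refine Finset.card_nsmul_le_sum _ _ _ fun c hc => ?_
      obtain ⟨x, hx, rfl⟩ := Finset.mem_image.1 (hU hc)
      obtain ⟨-, -, hx1, hxs⟩ := Finset.mem_filter.1 hx
      refine hxs.trans (Finset.card_le_card fun y hy => ?_)
      obtain ⟨-, hyt, hyx⟩ := Finset.mem_filter.1 hy
      have hy1 : y ≠ 1 := by
        rintro rfl
        rw [sub_self, zero_pow ht0] at hyx
        exact hT0 (hyx ▸ hU hc)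
      have hyR : y ∈ R := Finset.mem_filter.2 ⟨Finset.mem_univ _, hyt, hy1, by rwa [hyx]⟩
      exact Finset.mem_filter.2 ⟨Finset.mem_filter.2 ⟨hyR, by rwa [hyx]⟩, hyx⟩
    · intro x hx
      obtain ⟨hxR, hxU⟩ := Finset.mem_filter.1 hx
      exact ⟨(Finset.mem_filter.1 hxR).2.1, hxU⟩
  rcases T.eq_empty_or_nonempty with hT | hT
  · simp [Finset.image_eq_empty.1 (T_def.symm.trans hT)]
  have hb : 0 < b := Nat.pos_of_ne_zero (by rintro rfl; simp at htb; omega)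
  have hs0 : 0 < s := Nat.pos_of_ne_zero (by rintro rfl; simp at hs; omega)
  by_cases hTb : (t * #T) ^ 2 ≤ b ^ 3
  · obtain ⟨h1, h2⟩ := hkey T subset_rfl hT hTb
    have hR : R.filter (fun x => (x - 1) ^ t ∈ T) = R :=
      Finset.filter_true_of_mem fun x hx => Finset.mem_image_of_mem _ hx
    rw [hR] at h1 h2
    have hRpos : 0 < #R := (Finset.image_nonempty.1 hT).card_pos
    refine Nat.le_of_mul_le_mul_left (c := #R ^ 2) ?_ (by positivity)
    calc #R ^ 2 * (#R * s ^ 2) = #R ^ 3 * s ^ 2 := by ring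
      _ ≤ 2 ^ 12 * (t * #T) ^ 2 * s ^ 2 := by gcongr
      _ = 2 ^ 12 * t ^ 2 * (s * #T) ^ 2 := by ring
      _ ≤ 2 ^ 12 * t ^ 2 * #R ^ 2 := by gcongr
      _ = #R ^ 2 * (2 ^ 12 * t ^ 2) := by ring
  · exfalso
    set j := Nat.findGreatest (fun j => (t * j) ^ 2 ≤ b ^ 3) #T with j_def
    have hj1 : 1 ≤ j := Nat.le_findGreatest hT.card_pos (by simpa using htb)
    have hjb : (t * j) ^ 2 ≤ b ^ 3 :=
      Nat.findGreatest_spec (P := fun j => (t * j) ^ 2 ≤ b ^ 3) hT.card_pos (by simpa using htb)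
    have hjT : j < #T := lt_of_le_of_ne (Nat.findGreatest_le _) fun h => hTb (h ▸ hjb)
    have hjb' : b ^ 3 < (t * (j + 1)) ^ 2 :=
      not_le.1 (Nat.findGreatest_is_greatest (P := fun j => (t * j) ^ 2 ≤ b ^ 3)
        (Nat.lt_succ_self j) hjT)
    obtain ⟨U, hUT, hUj⟩ := Finset.exists_subset_card_eq hjT.le
    obtain ⟨h1, h2⟩ := hkey U hUT (Finset.card_pos.1 (by omega)) (by rwa [hUj])
    rw [hUj] at h1 h2
    have h3 : s ^ 3 * j ≤ 2 ^ 12 * t ^ 2 := by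
      refine Nat.le_of_mul_le_mul_left (c := j ^ 2) ?_ (by positivity)
      calc j ^ 2 * (s ^ 3 * j) = (s * j) ^ 3 := by ring
        _ ≤ 2 ^ 12 * (t * j) ^ 2 := (Nat.pow_le_pow_left h1 3).trans h2
        _ = j ^ 2 * (2 ^ 12 * t ^ 2) := by ring
    have h4 : (2 ^ 10 * t ^ 2) ^ 3 < (2 ^ 9 * t ^ 2) ^ 3 := by
      calc (2 ^ 10 * t ^ 2) ^ 3 ≤ (s ^ 2 * b) ^ 3 := by gcongr
        _ = s ^ 6 * b ^ 3 := by ring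
        _ < s ^ 6 * (t * (j + 1)) ^ 2 := by gcongr
        _ ≤ s ^ 6 * (t * (2 * j)) ^ 2 := by gcongr; omega
        _ = 4 * t ^ 2 * (s ^ 3 * j) ^ 2 := by ring
        _ ≤ 4 * t ^ 2 * (2 ^ 12 * t ^ 2) ^ 2 := by gcongr
        _ = 2 ^ 26 * t ^ 6 := by ring
        _ ≤ 2 ^ 27 * t ^ 6 := by gcongr <;> norm_num
        _ = (2 ^ 9 * t ^ 2) ^ 3 := by ring
    have := (Nat.pow_lt_pow_iff_left (n := 3) (by norm_num)).1 h4
    omega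

/-- Quadruples of `t`-th roots of unity with equal nonzero differences, counted by rich roots. -/
theorem card_energy_le_sum {K : Type*} [Field K] [DecidableEq K] [Fintype K] {t : ℕ} (ht : t ≠ 0)
    (B : Finset K) (hB : ∀ x ∈ B, x ^ t = 1) :
    #((B ×ˢ B ×ˢ B ×ˢ B).filter fun p =>
        p.1 - p.2.1 = p.2.2.1 - p.2.2.2 ∧ p.1 - p.2.1 ≠ 0)
      ≤ ∑ s ∈ Finset.Ioc 0 (Fintype.card K), min (#B ^ 2) (#B * #(richRoots K t s)) := by
  have hne : ∀ x ∈ B, x ≠ 0 := by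
    rintro x hx rfl
    simpa [ht] using hB 0 hx
  set E := (B ×ˢ B ×ˢ B ×ˢ B).filter fun p =>
    p.1 - p.2.1 = p.2.2.1 - p.2.2.2 ∧ p.1 - p.2.1 ≠ 0 with E_def
  set P := (B ×ˢ B).filter fun p => p.1 ≠ p.2 with P_def
  have hfiber : #E ≤ ∑ p ∈ P, #(rootsOfLevel t ((p.1 - p.2) ^ t)) := by
    rw [Finset.card_eq_sum_card_fiberwise (f := fun p => (p.1, p.2.1)) (t := P)]
    · refine Finset.sum_le_sum fun d hd => ?_
      refine Finset.card_le_card_of_injOn (fun p => p.2.2.1 / p.2.2.2) ?_ ?_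
      · rintro ⟨x, y, z, w⟩ h
        simp only [E_def, Finset.coe_filter, Finset.mem_filter, Finset.mem_product,
          Set.mem_ofPred_eq] at h
        obtain ⟨⟨⟨hx, hy, hz, hw⟩, h1, h2⟩, rfl⟩ := h
        simp only [rootsOfLevel, Finset.coe_filter, Finset.mem_univ, true_and, Set.mem_ofPred_eq]
        refine ⟨by rw [div_pow, hB z hz, hB w hw, div_one], ?_⟩
        rw [div_sub_one (hne w hw), div_pow, hB w hw, div_one, h1]
      · rintro ⟨x, y, z, w⟩ h ⟨x', y', z', w'⟩ h' heq
        simp only [E_def, Finset.coe_filter, Finset.mem_filter, Finset.mem_product,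
          Set.mem_ofPred_eq] at h h'
        obtain ⟨⟨⟨hx, hy, hz, hw⟩, h1, h2⟩, rfl⟩ := h
        obtain ⟨⟨⟨hx', hy', hz', hw'⟩, h1', h2'⟩, hd'⟩ := h'
        obtain ⟨rfl, rfl⟩ := Prod.mk.inj hd'
        simp only at heq
        have hzw : z * w' = z' * w := (div_eq_div_iff (hne w hw) (hne w' hw')).1 heq
        have h3 : (x' - y') * (w - w') = 0 := by
          linear_combination w * h1' - w' * h1 - hzw
        have h4 : w = w' := sub_eq_zero.1 ((mul_eq_zero.1 h3).resolve_left h2)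
        subst h4
        have h5 : z = z' := mul_right_cancel₀ (hne w hw) hzw
        rw [h5]
    · rintro ⟨x, y, z, w⟩ h
      simp only [E_def, P_def, Finset.coe_filter, Finset.mem_product, Set.mem_ofPred_eq] at h ⊢
      exact ⟨⟨h.1.1, h.1.2.1⟩, fun h0 => h.2.2 (sub_eq_zero.2 h0)⟩
  have hlayer : ∀ c : K, #(rootsOfLevel t c)
      = ∑ s ∈ Finset.Ioc 0 (Fintype.card K), if s ≤ #(rootsOfLevel t c) then 1 else 0 := by
    intro c
    rw [← Finset.card_filter]
    have : (Finset.Ioc 0 (Fintype.card K)).filter (· ≤ #(rootsOfLevel t c))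
        = Finset.Ioc 0 #(rootsOfLevel t c) := by
      ext s
      have := Finset.card_le_univ (rootsOfLevel t c)
      simp only [Finset.mem_filter, Finset.mem_Ioc]
      omega
    rw [this, Nat.card_Ioc, Nat.sub_zero]
  refine hfiber.trans ?_
  rw [Finset.sum_congr rfl fun p _ => hlayer ((p.1 - p.2) ^ t), Finset.sum_comm]
  refine Finset.sum_le_sum fun s _ => ?_
  rw [← Finset.card_filter]
  refine le_min ?_ ?_
  · refine (Finset.card_filter_le _ _).trans ((Finset.card_filter_le _ _).trans ?_)
    rw [Finset.card_product, sq]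
  · rw [← Finset.card_product]
    refine Finset.card_le_card_of_injOn (fun p => (p.2, p.1 / p.2)) ?_ ?_
    · rintro ⟨x, y⟩ h
      simp only [P_def, Finset.coe_filter, Finset.mem_filter, Finset.mem_product,
        Set.mem_ofPred_eq] at h
      obtain ⟨⟨⟨hx, hy⟩, hxy⟩, hs⟩ := h
      simp only [richRoots, Finset.coe_product, Set.mem_prod, Finset.mem_coe, Finset.mem_filter,
        Finset.mem_univ, true_and]
      refine ⟨hy, by rw [div_pow, hB x hx, hB y hy, div_one], ?_, ?_⟩
      · rwa [Ne, div_eq_one_iff_eq (hne y hy)]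
      · rwa [div_sub_one (hne y hy), div_pow, hB y hy, div_one]
    · rintro ⟨x, y⟩ h ⟨x', y'⟩ - heq
      simp only [P_def, Finset.coe_filter, Finset.mem_filter, Finset.mem_product,
        Set.mem_ofPred_eq] at h
      obtain ⟨rfl, h2⟩ := Prod.mk.inj heq
      simp only at h2
      rw [div_left_inj' (hne y h.1.1.2)] at h2
      rw [h2]

/-- Summing the layers of `card_energy_le_sum` against the decay of the rich roots. -/
theorem sum_min_le {b t N : ℕ} (r : ℕ → ℕ) (hb : 0 < b) (hbt : b ≤ t)
    (hr : ∀ s, 2 ^ 10 * t ^ 2 ≤ s ^ 2 * b → r s * s ^ 2 ≤ 2 ^ 12 * t ^ 2) :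
    ((∑ s ∈ Finset.Ioc 0 N, min (b ^ 2) (b * r s) : ℕ) : ℝ) ≤ 161 * (b * √b) * t := by
  have hb' : (1 : ℝ) ≤ b := by exact_mod_cast hb
  have hbt' : (b : ℝ) ≤ t := by exact_mod_cast hbt
  have hsq : √(b : ℝ) * √b = b := Real.mul_self_sqrt (by positivity)
  have hsq1 : 1 ≤ √(b : ℝ) := Real.one_le_sqrt.2 hb'
  have hsqb : √(b : ℝ) ≤ t := by nlinarith
  set k := ⌈32 * t / √(b : ℝ)⌉₊ with k_def
  have hk1 : 32 * t / √(b : ℝ) ≤ k := Nat.le_ceil _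
  have hk2 : (k : ℝ) ≤ 33 * t / √(b : ℝ) := by
    have h1 : (k : ℝ) < 32 * t / √(b : ℝ) + 1 := Nat.ceil_lt_add_one (by positivity)
    have h2 : 1 ≤ t / √(b : ℝ) := (one_le_div (by positivity)).2 hsqb
    have h3 : 33 * t / √(b : ℝ) = 32 * t / √(b : ℝ) + t / √(b : ℝ) := by ring
    linarith
  have ht0 : (0 : ℝ) < t := by linarith
  have hk0 : (0 : ℝ) < k := lt_of_lt_of_le (by positivity) hk1
  have hk0' : k ≠ 0 := by exact_mod_cast hk0.ne'
  rw [div_le_iff₀ (by positivity)] at hk1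
  rw [le_div_iff₀ (by positivity)] at hk2
  have hsplit : ∑ s ∈ Finset.Ioc 0 N, min (b ^ 2) (b * r s)
      ≤ ∑ s ∈ Finset.Ioc 0 k, b ^ 2 + ∑ s ∈ Finset.Ioc k (max k N), b * r s := by
    calc ∑ s ∈ Finset.Ioc 0 N, min (b ^ 2) (b * r s)
        ≤ ∑ s ∈ Finset.Ioc 0 (max k N), min (b ^ 2) (b * r s) :=
          Finset.sum_le_sum_of_subset (Finset.Ioc_subset_Ioc_right (le_max_right _ _))
      _ = ∑ s ∈ Finset.Ioc 0 k, min (b ^ 2) (b * r s)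
          + ∑ s ∈ Finset.Ioc k (max k N), min (b ^ 2) (b * r s) :=
          (Finset.sum_Ioc_consecutive _ (Nat.zero_le _) (le_max_left _ _)).symm
      _ ≤ _ := add_le_add (Finset.sum_le_sum fun _ _ => min_le_left _ _)
          (Finset.sum_le_sum fun _ _ => min_le_right _ _)
  have hhead : ((∑ s ∈ Finset.Ioc 0 k, b ^ 2 : ℕ) : ℝ) ≤ 33 * (b * √b) * t := by
    simp only [Finset.sum_const, Nat.card_Ioc, Nat.sub_zero, smul_eq_mul, Nat.cast_mul,
      Nat.cast_pow]
    calc (k : ℝ) * b ^ 2 = k * √b * (b * √b) := by linear_combination (-(k : ℝ) * b) * hsq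
      _ ≤ 33 * t * (b * √b) := by gcongr
      _ = 33 * (b * √b) * t := by ring
  have htail : ((∑ s ∈ Finset.Ioc k (max k N), b * r s : ℕ) : ℝ) ≤ 128 * (b * √b) * t := by
    push_cast
    have hterm : ∀ s ∈ Finset.Ioc k (max k N),
        (b : ℝ) * r s ≤ b * (2 ^ 12 * t ^ 2) * ((s : ℝ) ^ 2)⁻¹ := by
      intro s hs
      have hks : (k : ℝ) ≤ s := by exact_mod_cast (Finset.mem_Ioc.1 hs).1.le
      have hs0 : (0 : ℝ) < s := hk0.trans_le hks
      have h1 : 2 ^ 10 * t ^ 2 ≤ s ^ 2 * b := by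
        have : (2 ^ 10 * t ^ 2 : ℝ) ≤ s ^ 2 * b := by
          calc (2 ^ 10 * t ^ 2 : ℝ) = (32 * t) ^ 2 := by ring
            _ ≤ (s * √b) ^ 2 := by
              have h0 : 32 * (t : ℝ) ≤ s * √b := hk1.trans (by gcongr)
              gcongr
            _ = s ^ 2 * b := by rw [mul_pow, Real.sq_sqrt (by positivity)]
        exact_mod_cast this
      have h2 : (r s * s ^ 2 : ℝ) ≤ 2 ^ 12 * t ^ 2 := by exact_mod_cast hr s h1
      rw [mul_assoc, ← div_eq_mul_inv]
      gcongr
      rwa [le_div_iff₀ (by positivity)]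
    refine (Finset.sum_le_sum hterm).trans ?_
    rw [← Finset.mul_sum]
    have h3 : ∑ s ∈ Finset.Ioc k (max k N), ((s : ℝ) ^ 2)⁻¹ ≤ (k : ℝ)⁻¹ :=
      (sum_Ioc_inv_sq_le_sub hk0' (le_max_left _ _)).trans (sub_le_self _ (by positivity))
    have h4 : t * (k : ℝ)⁻¹ ≤ √b / 32 := by
      rw [← div_eq_mul_inv, div_le_iff₀ hk0]
      linarith
    calc (b : ℝ) * (2 ^ 12 * t ^ 2) * ∑ s ∈ Finset.Ioc k (max k N), ((s : ℝ) ^ 2)⁻¹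
        ≤ b * (2 ^ 12 * t ^ 2) * (k : ℝ)⁻¹ := by gcongr
      _ = 2 ^ 12 * b * t * (t * (k : ℝ)⁻¹) := by ring
      _ ≤ 2 ^ 12 * b * t * (√b / 32) := by gcongr
      _ = 128 * (b * √b) * t := by ring
  calc ((∑ s ∈ Finset.Ioc 0 N, min (b ^ 2) (b * r s) : ℕ) : ℝ)
      ≤ ((∑ s ∈ Finset.Ioc 0 k, b ^ 2 + ∑ s ∈ Finset.Ioc k (max k N), b * r s : ℕ) : ℝ) := by
        exact_mod_cast hsplit
    _ ≤ 33 * (b * √b) * t + 128 * (b * √b) * t := by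
        rw [Nat.cast_add]
        exact add_le_add hhead htail
    _ = 161 * (b * √b) * t := by ring

theorem card_filter_sub_eq_sub_le {K : Type*} [Field K] [DecidableEq K] (B : Finset K) :
    #((B ×ˢ B ×ˢ B ×ˢ B).filter fun p =>
        p.1 - p.2.1 = p.2.2.1 - p.2.2.2 ∧ p.1 - p.2.1 ≠ 0) ≤ #B ^ 3 := by
  calc _ ≤ #(B ×ˢ B ×ˢ B) := by
        refine Finset.card_le_card_of_injOn (fun p => (p.1, p.2.1, p.2.2.1)) ?_ ?_
        · rintro ⟨x, y, z, w⟩ h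
          simp only [Finset.coe_filter, Finset.mem_product, Set.mem_ofPred_eq] at h
          simp [h.1]
        · rintro ⟨x, y, z, w⟩ h ⟨x', y', z', w'⟩ h' heq
          simp only [Finset.coe_filter, Set.mem_ofPred_eq] at h h'
          simp only [Prod.mk.injEq] at heq ⊢
          obtain ⟨rfl, rfl, rfl⟩ := heq
          exact ⟨rfl, rfl, rfl, by linear_combination h.2.1 - h'.2.1⟩
    _ = #B ^ 3 := by
        simp only [Finset.card_product]
        ring

/-- **Additive-energy bound (inequality (18) in Konyagin's proof of Lemma 5).**
There is an absolute constant `C > 0` such that: if `q` is prime, `G` is a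
multiplicative subgroup of `F* = (ℤ/qℤ)*`, and `B ⊆ G` with `|B| < |F|^(1/2)`,
then the number of quadruples `(b₁,b₂,b₃,b₄) ∈ B⁴` with `b₁-b₂ = b₃-b₄ ≠ 0` is at
most `C * |B|^(3/2) * |G|`. -/
theorem energy_bound_of_subset_subgroup :
    ∃ C > (0 : ℝ), ∀ q : ℕ, q.Prime → ∀ G : Subgroup (ZMod q)ˣ,
      ∀ B : Finset (ZMod q), (∀ b ∈ B, ∃ u ∈ G, ((u : (ZMod q)ˣ) : ZMod q) = b) →
        (B.card : ℝ) < (q : ℝ) ^ ((1 : ℝ) / 2) →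
          ((((B ×ˢ B ×ˢ B ×ˢ B).filter fun p =>
              p.1 - p.2.1 = p.2.2.1 - p.2.2.2 ∧ p.1 - p.2.1 ≠ 0).card : ℝ)
            ≤ C * (B.card : ℝ) ^ ((3 : ℝ) / 2) * (Nat.card G : ℝ)) := by
  refine ⟨161, by norm_num, fun q hq G B hBG hBq => ?_⟩
  have : Fact q.Prime := ⟨hq⟩
  rcases B.eq_empty_or_nonempty with rfl | hBne
  · simp
  set t := Nat.card G with t_def
  have hb : 0 < #B := hBne.card_pos
  have hb' : (0 : ℝ) < #B := by exact_mod_cast hb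
  have hpow : (#B : ℝ) ^ ((3 : ℝ) / 2) = #B * √(#B : ℝ) := by
    rw [show (3 : ℝ) / 2 = 1 + 1 / 2 by norm_num, Real.rpow_add hb', Real.rpow_one,
      ← Real.sqrt_eq_rpow]
  have hbq : #B ^ 2 ≤ q := by
    rw [← Real.sqrt_eq_rpow, Real.lt_sqrt (by positivity)] at hBq
    exact_mod_cast hBq.le
  have hB : ∀ x ∈ B, x ^ t = 1 := by
    intro x hx
    obtain ⟨u, hu, rfl⟩ := hBG x hx
    have h1 : u ^ t = 1 :=
      congrArg Subtype.val (pow_card_eq_one' (x := (⟨u, hu⟩ : G)))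
    rw [← Units.val_pow_eq_pow_val, h1, Units.val_one]
  have hbt : #B ≤ t := by
    have hsub : (B : Set (ZMod q)) ⊆ Set.image (fun u : (ZMod q)ˣ => (u : ZMod q)) G :=
      fun x hx => hBG x hx
    have h1 := Set.ncard_le_ncard hsub (Set.toFinite _)
    rw [Set.ncard_coe_finset] at h1
    exact h1.trans (Set.ncard_image_le (Set.toFinite _))
  have ht : 0 < t := hb.trans_le hbt
  have ht' : (0 : ℝ) < t := by exact_mod_cast ht
  rw [hpow]
  have htriv : (((B ×ˢ B ×ˢ B ×ˢ B).filter fun p =>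
      p.1 - p.2.1 = p.2.2.1 - p.2.2.2 ∧ p.1 - p.2.1 ≠ 0).card : ℝ)
      ≤ (#B * √(#B : ℝ)) * (#B * √(#B : ℝ)) := by
    calc _ ≤ (#B : ℝ) ^ 3 := by exact_mod_cast card_filter_sub_eq_sub_le B
      _ = _ := by linear_combination -(#B : ℝ) ^ 2 * Real.mul_self_sqrt hb'.le
  by_cases hsmall : t < 64
  · refine htriv.trans ?_
    have h1 : √(#B : ℝ) ≤ 8 := by
      rw [Real.sqrt_le_left (by norm_num)]
      have : #B ≤ 64 := by omega
      norm_num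
      exact_mod_cast this
    have h2 : #B * √(#B : ℝ) ≤ t * 8 := by gcongr
    calc (#B * √(#B : ℝ)) * (#B * √(#B : ℝ)) ≤ (#B * √(#B : ℝ)) * (t * 8) := by gcongr
      _ = 8 * (#B * √(#B : ℝ)) * t := by ring
      _ ≤ 161 * (#B * √(#B : ℝ)) * t := by gcongr; norm_num
  by_cases hlarge : #B ^ 3 < t ^ 2
  · refine htriv.trans ?_
    have h2 : #B * √(#B : ℝ) ≤ t := by
      refine (pow_le_pow_iff_left₀ (by positivity) ht'.le two_ne_zero).1 ?_
      rw [mul_pow, Real.sq_sqrt hb'.le]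
      exact_mod_cast hlarge.le
    calc (#B * √(#B : ℝ)) * (#B * √(#B : ℝ)) ≤ (#B * √(#B : ℝ)) * t := by gcongr
      _ = 1 * (#B * √(#B : ℝ)) * t := by ring
      _ ≤ 161 * (#B * √(#B : ℝ)) * t := by gcongr; norm_num
  · refine le_trans ?_ (sum_min_le (N := Fintype.card (ZMod q))
      (fun s => #(richRoots (ZMod q) t s)) hb hbt fun s hs =>
        card_richRoots_mul_sq_le q (not_lt.1 hsmall) hbt hbq (not_lt.1 hlarge) hs)
    have hE := card_energy_le_sum ht.ne' B hB
    exact_mod_cast hE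
end
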